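/- arXiv:2301.00273 — 2 statements merged into one kernel-verified Lean document; each statement's English description precedes it below -/
import Mathlib

section
/- Let n ≥ 1 and let A_1,…,A_n ⊆ ℝ^n be finite nonempty sets with cardinalities t_1,…,t_n and convex hulls P_1,…,P_n, respectively. Let V_0 denote the number of vertices (extreme points) of the Minkowski sum P_1 + … + P_n. Then E(A_1,…,A_n) ≤ (2π)^{−n/2} · V_0 · (t_1 − 1)·(t_2 − 1)⋯(t_n − 1). -/
open MeasureTheory ProbabilityTheory Pointwise
open scoped ENNReal RealInnerProductSpace

noncomputable section

/-- `F_{A,c}(w) = ∑_{a ∈ A} c(a) · exp⟨a,w⟩`. -/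
def Fexp {n : ℕ} (A : Finset (EuclideanSpace ℝ (Fin n))) (c : A → ℝ)
    (w : EuclideanSpace ℝ (Fin n)) : ℝ :=
  ∑ a : A, c a * Real.exp ⟪(a : EuclideanSpace ℝ (Fin n)), w⟫

/-- The fewnomial system `(F_{A_1,c_1},…,F_{A_n,c_n})` as a map `ℝ^n → ℝ^n`. -/
def sysF {n : ℕ} (A : Fin n → Finset (EuclideanSpace ℝ (Fin n)))
    (c : ∀ i, A i → ℝ) (w : EuclideanSpace ℝ (Fin n)) : Fin n → ℝ :=
  fun i => Fexp (A i) (c i) w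

/-- The set of nondegenerate common zeros of the system: the Jacobian
(i.e. the derivative) at the zero is invertible. -/
def nondegZeros {n : ℕ} (A : Fin n → Finset (EuclideanSpace ℝ (Fin n)))
    (c : ∀ i, A i → ℝ) : Set (EuclideanSpace ℝ (Fin n)) :=
  {w | sysF A c w = 0 ∧ Function.Bijective (fderiv ℝ (sysF A c) w)}

/-- Independent standard Gaussian coefficients `c_i(a)`, `i = 1,…,n`, `a ∈ A_i`. -/
def coeffMeasure {n : ℕ} (A : Fin n → Finset (EuclideanSpace ℝ (Fin n))) :
    Measure (∀ i, A i → ℝ) :=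
  Measure.pi fun _ => Measure.pi fun _ => gaussianReal 0 1

/-- `E(A_1,…,A_n)`: the expected number of nondegenerate common zeros. -/
def EE {n : ℕ} (A : Fin n → Finset (EuclideanSpace ℝ (Fin n))) : ℝ≥0∞ :=
  ∫⁻ c, ((nondegZeros A c).encard : ℝ≥0∞) ∂(coeffMeasure A)

theorem HasStrictFDerivAt.exists_mem_nhds_injOn {E F : Type*} [NormedAddCommGroup E]
    [NormedSpace ℝ E] [FiniteDimensional ℝ E] [NormedAddCommGroup F] [NormedSpace ℝ F]
    {f : E → F} {f' : E →L[ℝ] F} {p : E} (hf : HasStrictFDerivAt f f' p)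
    (hinj : Function.Injective f') : ∃ U ∈ nhds p, Set.InjOn f U := by
  obtain ⟨K, hK, hanti⟩ := (f' : E →ₗ[ℝ] F).exists_antilipschitzWith (LinearMap.ker_eq_bot.2 hinj)
  have hK' : (0 : ℝ) < K := hK
  have hlittle := hf.isLittleO.def (c := (2 * K : ℝ)⁻¹) (by positivity)
  obtain ⟨U, hU, hUsub⟩ := Filter.mem_prod_same_iff.1 (nhds_prod_eq (x := p) (y := p) ▸ hlittle)
  refine ⟨U, hU, fun x hx y hy hxy => ?_⟩
  have h1 : ‖f x - f y - f' (x - y)‖ ≤ (2 * K : ℝ)⁻¹ * ‖x - y‖ := hUsub (Set.mk_mem_prod hx hy)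
  have h2 : ‖x - y‖ ≤ K * ‖f' (x - y)‖ := by
    simpa [dist_eq_norm] using hanti.le_mul_dist x y
  rw [hxy, sub_self, zero_sub, norm_neg] at h1
  have h3 : ‖x - y‖ ≤ K * ((2 * K : ℝ)⁻¹ * ‖x - y‖) :=
    h2.trans (mul_le_mul_of_nonneg_left h1 hK'.le)
  have h4 : K * ((2 * K : ℝ)⁻¹ * ‖x - y‖) = ‖x - y‖ / 2 := by field_simp
  have h5 : ‖x - y‖ ≤ 0 := by linarith
  exact sub_eq_zero.1 (norm_le_zero_iff.1 h5)

/-- A measurable set on which a map is locally injective splits into countably many disjoint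
measurable pieces on which the map is injective. -/
theorem exists_measurable_partition_injOn {α β : Type*} [TopologicalSpace α]
    [SecondCountableTopology α] [MeasurableSpace α] [OpensMeasurableSpace α]
    {f : α → β} {T : Set α} (hT : MeasurableSet T)
    (hloc : ∀ p ∈ T, ∃ U ∈ nhds p, Set.InjOn f U) :
    ∃ S : ℕ → Set α, (∀ k, MeasurableSet (S k)) ∧ Pairwise (Function.onFun Disjoint S) ∧
      (⋃ k, S k) = T ∧ ∀ k, Set.InjOn f (S k) := by
  have hopen : ∀ p, ∃ U, IsOpen U ∧ (p ∈ T → p ∈ U) ∧ Set.InjOn f U := by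
    intro p
    by_cases hp : p ∈ T
    · obtain ⟨U, hU, hinj⟩ := hloc p hp
      exact ⟨interior U, isOpen_interior, fun _ => mem_interior_iff_mem_nhds.2 hU,
        hinj.mono interior_subset⟩
    · exact ⟨∅, isOpen_empty, fun h => absurd h hp, by simp⟩
  choose U hUo hUmem hUinj using hopen
  obtain ⟨t, -, htc, htU⟩ := TopologicalSpace.countable_cover_nhdsWithin (f := U) (s := T)
    fun p hp => mem_nhdsWithin_of_mem_nhds ((hUo p).mem_nhds (hUmem p hp))
  rcases t.eq_empty_or_nonempty with rfl | hne
  · exact ⟨fun _ => ∅, by simp, by simp [Pairwise],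
      by simpa using (Set.subset_eq_empty htU (by simp)).symm, by simp⟩
  obtain ⟨e, rfl⟩ := htc.exists_eq_range hne
  refine ⟨disjointed fun k => T ∩ U (e k), fun k => MeasurableSet.disjointed
    (fun j => hT.inter (hUo _).measurableSet) k, disjoint_disjointed _, ?_, fun k => ?_⟩
  · rw [iUnion_disjointed, ← Set.inter_iUnion, Set.inter_eq_left]
    simpa using htU
  · exact (hUinj (e k)).mono ((disjointed_subset _ k).trans Set.inter_subset_right)

theorem encard_fiber_eq_tsum {α β : Type*} {f : α → β} {T : Set α} {S : ℕ → Set α}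
    (hdisj : Pairwise (Function.onFun Disjoint S)) (hU : (⋃ k, S k) = T)
    (hinj : ∀ k, Set.InjOn f (S k)) (y : β) :
    (({p | p ∈ T ∧ f p = y}.encard : ℕ∞) : ℝ≥0∞) =
      ∑' k, (f '' S k).indicator (fun _ => (1 : ℝ≥0∞)) y := by
  let _ : MeasurableSpace α := ⊤
  have hset : {p | p ∈ T ∧ f p = y} = ⋃ k, S k ∩ f ⁻¹' {y} := by
    rw [← Set.iUnion_inter, hU]; rfl
  rw [← Measure.count_apply (MeasurableSpace.measurableSet_top), hset,
    measure_iUnion (fun i j hij => (hdisj hij).mono Set.inter_subset_left Set.inter_subset_left)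
      (fun _ => MeasurableSpace.measurableSet_top)]
  refine tsum_congr fun k => ?_
  rw [Measure.count_apply (MeasurableSpace.measurableSet_top)]
  by_cases hy : y ∈ f '' S k
  · obtain ⟨x, hx, rfl⟩ := hy
    have : S k ∩ f ⁻¹' {f x} = {x} := by
      ext z
      constructor
      · rintro ⟨hz, hzx⟩
        exact hinj k hz hx hzx
      · rintro rfl
        exact ⟨hx, rfl⟩
    rw [this, Set.indicator_of_mem (Set.mem_image_of_mem f hx)]
    simp
  · have : S k ∩ f ⁻¹' {y} = ∅ := by
      ext z
      simp only [Set.mem_inter_iff, Set.mem_preimage, Set.mem_singleton_iff, Set.mem_empty_iff_false,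
        iff_false, not_and]
      exact fun hz hzy => hy ⟨z, hz, hzy⟩
    rw [this, Set.indicator_of_notMem hy]
    simp

/-- The number of preimages of a point under a locally injective continuous map is measurable. -/
theorem measurable_encard_fiber {α β : Type*} [TopologicalSpace α] [PolishSpace α]
    [MeasurableSpace α] [BorelSpace α] [TopologicalSpace β] [T2Space β]
    [SecondCountableTopology β] [MeasurableSpace β] [OpensMeasurableSpace β]
    {f : α → β} (hf : Continuous f) {T : Set α} (hT : MeasurableSet T)
    (hloc : ∀ p ∈ T, ∃ U ∈ nhds p, Set.InjOn f U) :
    Measurable fun y => (({p | p ∈ T ∧ f p = y}.encard : ℕ∞) : ℝ≥0∞) := by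
  obtain ⟨S, hS, hdisj, hU, hinj⟩ := exists_measurable_partition_injOn hT hloc
  simp_rw [encard_fiber_eq_tsum hdisj hU hinj]
  exact Measurable.tsum fun k => measurable_const.indicator
    ((hS k).image_of_continuousOn_injOn hf.continuousOn (hinj k))

/-- The area formula for a `C¹` map which is not necessarily injective. -/
theorem lintegral_encard_fiber_eq {E : Type*} [NormedAddCommGroup E] [NormedSpace ℝ E]
    [FiniteDimensional ℝ E] [MeasurableSpace E] [BorelSpace E] (μ : Measure E)
    [μ.IsAddHaarMeasure] {h : E → E} (hh : ContDiff ℝ 1 h) {T : Set E} (hT : MeasurableSet T)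
    (hinj : ∀ x ∈ T, Function.Injective (fderiv ℝ h x)) :
    ∫⁻ y, (({x | x ∈ T ∧ h x = y}.encard : ℕ∞) : ℝ≥0∞) ∂μ =
      ∫⁻ x in T, ENNReal.ofReal |(fderiv ℝ h x).det| ∂μ := by
  have : CompleteSpace E := FiniteDimensional.complete ℝ E
  have : ProperSpace E := FiniteDimensional.proper ℝ E
  obtain ⟨S, hS, hdisj, hU, hSinj⟩ := exists_measurable_partition_injOn (f := h) hT fun x hx =>
    (hh.contDiffAt.hasStrictFDerivAt (by simp)).exists_mem_nhds_injOn (hinj x hx)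
  have himg : ∀ k, MeasurableSet (h '' S k) := fun k =>
    (hS k).image_of_continuousOn_injOn hh.continuous.continuousOn (hSinj k)
  simp_rw [encard_fiber_eq_tsum hdisj hU hSinj]
  rw [lintegral_tsum fun k => (measurable_const.indicator (himg k)).aemeasurable, ← hU,
    lintegral_iUnion hS hdisj]
  refine tsum_congr fun k => ?_
  rw [lintegral_indicator (himg k), setLIntegral_one,
    lintegral_abs_det_fderiv_eq_addHaar_image μ (hS k) (fun x _ =>
      ((hh.differentiable (by simp)) x).hasFDerivAt.hasFDerivWithinAt) (hSinj k)]

theorem lintegral_fin_prod_eq_prod : ∀ {n : ℕ} {α : Fin n → Type*}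
    [∀ i, MeasurableSpace (α i)] (μ : ∀ i, Measure (α i)) [∀ i, SigmaFinite (μ i)]
    {f : ∀ i, α i → ℝ≥0∞} (_ : ∀ i, Measurable (f i)),
    ∫⁻ x, ∏ i, f i (x i) ∂(Measure.pi μ) = ∏ i, ∫⁻ x, f i x ∂(μ i)
  | 0, α, _, μ, _, f, hf => by
    simp
  | n + 1, α, _, μ, _, f, hf => by
    have hm : Measurable fun y : ∀ i : Fin n, α i.succ => ∏ i, f i.succ (y i) := by
      have := fun i => hf (Fin.succ i)
      fun_prop
    rw [← ((measurePreserving_piFinSuccAbove μ 0).symm).lintegral_comp_emb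
      (MeasurableEquiv.measurableEmbedding _), Fin.prod_univ_succ,
      ← lintegral_fin_prod_eq_prod (fun i => μ (Fin.succ i)) (fun i => hf (Fin.succ i)),
      ← lintegral_prod_mul (hf 0).aemeasurable hm.aemeasurable]
    refine lintegral_congr fun x => ?_
    rw [Fin.prod_univ_succ]
    rfl

theorem measurePreserving_pi_prod {ι : Type*} [Fintype ι] {α β : ι → Type*}
    [∀ i, MeasurableSpace (α i)] [∀ i, MeasurableSpace (β i)]
    (μ : ∀ i, Measure (α i)) (ν : ∀ i, Measure (β i))
    [∀ i, SigmaFinite (μ i)] [∀ i, SigmaFinite (ν i)] :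
    MeasurePreserving (fun (z : ∀ i, α i × β i) => ((fun i => (z i).1), fun i => (z i).2))
      (Measure.pi fun i => (μ i).prod (ν i)) ((Measure.pi μ).prod (Measure.pi ν)) where
  measurable := by fun_prop
  map_eq := by
    symm
    refine Measure.prod_eq_generateFrom generateFrom_pi generateFrom_pi isPiSystem_pi isPiSystem_pi
      (Measure.FiniteSpanningSetsIn.pi fun i => (μ i).toFiniteSpanningSetsIn)
      (Measure.FiniteSpanningSetsIn.pi fun i => (ν i).toFiniteSpanningSetsIn) ?_
    rintro _ ⟨s, hs, rfl⟩ _ ⟨t, ht, rfl⟩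
    simp only [Set.mem_pi, Set.mem_univ, true_imp_iff, Set.mem_ofPred_eq] at hs ht
    rw [Measure.map_apply (by fun_prop)
      ((MeasurableSet.univ_pi hs).prod (MeasurableSet.univ_pi ht))]
    have : (fun (z : ∀ i, α i × β i) => ((fun i => (z i).1), fun i => (z i).2)) ⁻¹'
        (Set.univ.pi s ×ˢ Set.univ.pi t) = Set.univ.pi fun i => s i ×ˢ t i := by
      ext; simp [Set.mem_pi, forall_and]
    simp_rw [this, Measure.pi_pi, Measure.prod_prod, Finset.prod_mul_distrib]

theorem measurePreserving_update {κ α : Type*} [Fintype κ] [DecidableEq κ] [MeasurableSpace α]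
    (μ : Measure α) [IsProbabilityMeasure μ] (k : κ) :
    MeasurePreserving (fun p : (κ → α) × α => Function.update p.1 k p.2)
      ((Measure.pi fun _ => μ).prod μ) (Measure.pi fun _ => μ) := by
  have hm : Measurable fun p : (κ → α) × α => Function.update p.1 k p.2 := by
    refine measurable_pi_lambda _ fun j => ?_
    by_cases h : j = k
    · subst h; simpa using measurable_snd
    · simp only [Function.update_of_ne h]; fun_prop
  refine ⟨hm, ?_⟩
  symm
  refine Measure.pi_eq fun s hs => ?_
  rw [Measure.map_apply hm (MeasurableSet.univ_pi hs)]
  have : (fun p : (κ → α) × α => Function.update p.1 k p.2) ⁻¹' (Set.univ.pi s) =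
      (Set.univ.pi (Function.update s k Set.univ)) ×ˢ s k := by
    ext ⟨c, y⟩
    simp only [Set.mem_preimage, Set.mem_pi, Set.mem_univ, true_imp_iff, Set.mem_prod]
    constructor
    · refine fun h => ⟨fun i => ?_, by simpa using h k⟩
      by_cases hi : i = k
      · subst hi; simp
      · simpa [Function.update_of_ne hi] using h i
    · rintro ⟨h1, h2⟩ i
      by_cases hi : i = k
      · subst hi; simpa using h2
      · simpa [Function.update_of_ne hi] using h1 i
  rw [this, Measure.prod_prod, Measure.pi_pi, ← Finset.mul_prod_erase _ _ (Finset.mem_univ k),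
    ← Finset.mul_prod_erase Finset.univ (fun i => μ (s i)) (Finset.mem_univ k)]
  simp only [Function.update_self, measure_univ, one_mul]
  rw [mul_comm]
  congr 1
  exact Finset.prod_congr rfl fun i hi => by rw [Function.update_of_ne (Finset.ne_of_mem_erase hi)]

/-- Resampling one coordinate in each block preserves the product measure. -/
theorem measurePreserving_pi_update {ι : Type*} [Fintype ι] {κ : ι → Type*} {α : Type*}
    [∀ i, Fintype (κ i)] [∀ i, DecidableEq (κ i)] [MeasurableSpace α]
    (μ : Measure α) [IsProbabilityMeasure μ] (k : ∀ i, κ i) :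
    MeasurePreserving
      (fun p : (∀ i, κ i → α) × (ι → α) => fun i => Function.update (p.1 i) (k i) (p.2 i))
      ((Measure.pi fun _ => Measure.pi fun _ => μ).prod (Measure.pi fun _ => μ))
      (Measure.pi fun _ => Measure.pi fun _ => μ) := by
  have hu := fun i => measurePreserving_update μ (k i)
  have h1 := measurePreserving_pi_prod (fun i => Measure.pi fun _ : κ i => μ) fun _ => μ
  have h2 := measurePreserving_pi _ _ hu
  have hm : Measurable
      (fun p : (∀ i, κ i → α) × (ι → α) => fun i => Function.update (p.1 i) (k i) (p.2 i)) := by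
    refine measurable_pi_lambda _ fun i => ?_
    have : Measurable fun p : (∀ i, κ i → α) × (ι → α) => (p.1 i, p.2 i) := by fun_prop
    exact (hu i).measurable.comp this
  refine ⟨hm, ?_⟩
  rw [← h1.map_eq, Measure.map_map hm h1.measurable]
  exact h2.map_eq

theorem pi_gaussianReal_le (n : ℕ) :
    (Measure.pi fun _ : Fin n => gaussianReal 0 1) ≤
      ENNReal.ofReal ((2 * Real.pi) ^ (-(n : ℝ) / 2)) • (volume : Measure (Fin n → ℝ)) := by
  have hpi : (Measure.pi fun _ : Fin n => gaussianReal 0 1) =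
      (volume : Measure (Fin n → ℝ)).withDensity fun y => ∏ i, gaussianPDF 0 1 (y i) := by
    refine Measure.pi_eq fun s hs => ?_
    rw [withDensity_apply _ (MeasurableSet.univ_pi hs), volume_pi, Measure.restrict_pi_pi,
      lintegral_fin_prod_eq_prod _ fun _ => measurable_gaussianPDF 0 1]
    refine Finset.prod_congr rfl fun i _ => ?_
    rw [gaussianReal_apply _ one_ne_zero]
  have hconst : ENNReal.ofReal ((2 * Real.pi) ^ (-(n : ℝ) / 2)) =
      ∏ _i : Fin n, ENNReal.ofReal (√(2 * Real.pi))⁻¹ := by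
    rw [Finset.prod_const, Finset.card_univ, Fintype.card_fin,
      ← ENNReal.ofReal_pow (by positivity), Real.sqrt_eq_rpow, ← Real.rpow_neg (by positivity),
      ← Real.rpow_natCast, ← Real.rpow_mul (by positivity)]
    congr 2; ring
  rw [hpi, ← withDensity_const]
  refine withDensity_mono (Filter.Eventually.of_forall fun y => ?_)
  rw [hconst]
  refine Finset.prod_le_prod' fun i _ => ENNReal.ofReal_le_ofReal ?_
  rw [gaussianPDFReal]
  simp only [NNReal.coe_one, mul_one, sub_zero]
  refine mul_le_of_le_one_right (by positivity) (Real.exp_le_one_iff.2 ?_)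
  have := sq_nonneg (y i)
  linarith

theorem lintegral_abs_gaussianReal_le_one :
    ∫⁻ x, ENNReal.ofReal |x| ∂(gaussianReal 0 1) ≤ 1 := by
  have hsq : ∫ x, x ^ 2 ∂(gaussianReal 0 1) = 1 := by
    have h := variance_id_gaussianReal (μ := 0) (v := 1)
    rw [variance_eq_integral aemeasurable_id] at h
    simpa using h
  have hint : Integrable (fun x : ℝ => x ^ 2) (gaussianReal 0 1) := by
    by_contra h
    rw [integral_undef h] at hsq
    exact zero_ne_one hsq
  have hint' : Integrable (fun x : ℝ => (1 + x ^ 2) / 2) (gaussianReal 0 1) :=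
    ((integrable_const 1).add hint).div_const 2
  calc ∫⁻ x, ENNReal.ofReal |x| ∂(gaussianReal 0 1)
      ≤ ∫⁻ x, ENNReal.ofReal ((1 + x ^ 2) / 2) ∂(gaussianReal 0 1) :=
        lintegral_mono fun x => ENNReal.ofReal_le_ofReal (by
          nlinarith [sq_nonneg (|x| - 1), sq_abs x])
    _ = ENNReal.ofReal (∫ x, (1 + x ^ 2) / 2 ∂(gaussianReal 0 1)) :=
        (ofReal_integral_eq_lintegral_ofReal hint'
          (Filter.Eventually.of_forall fun x => by positivity)).symm
    _ = 1 := by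
        rw [integral_div, integral_add (integrable_const 1) hint, hsq]
        norm_num

/-- `∫ |det D| exp(∑ᵢ (D x)ᵢ) ≤ 1` over any set on which all coordinates of `D x` are
nonpositive. -/
theorem lintegral_abs_det_mul_exp_le_one {n : ℕ} (D : Matrix (Fin n) (Fin n) ℝ)
    {S : Set (Fin n → ℝ)} (hS : MeasurableSet S) (hSD : ∀ x ∈ S, ∀ i, D.mulVec x i ≤ 0) :
    ∫⁻ x in S, ENNReal.ofReal |D.det| * ENNReal.ofReal (Real.exp (∑ i, D.mulVec x i)) ≤ 1 := by
  by_cases hD : D.det = 0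
  · simp [hD]
  set T : (Fin n → ℝ) →L[ℝ] (Fin n → ℝ) := LinearMap.toContinuousLinearMap (Matrix.toLin' D)
  have hT : ∀ x, T x = D.mulVec x := fun x => by simp [T]
  have hdet : T.det = D.det := by simp [T, ContinuousLinearMap.det]
  have hinj : Set.InjOn T S := by
    intro x _ y _ hxy
    rw [hT, hT] at hxy
    exact Matrix.mulVec_injective_iff_isUnit.2
      ((Matrix.isUnit_iff_isUnit_det D).2 (isUnit_iff_ne_zero.2 hD)) hxy
  have key := lintegral_image_eq_lintegral_abs_det_fderiv_mul volume hS
    (fun x _ => T.hasFDerivAt.hasFDerivWithinAt) hinj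
    (fun u => ENNReal.ofReal (Real.exp (∑ i, u i)))
  simp only [hdet, hT] at key
  rw [← key]
  calc ∫⁻ u in (fun x => T x) '' S, ENNReal.ofReal (Real.exp (∑ i, u i))
      ≤ ∫⁻ u in Set.univ.pi fun _ => Set.Iic 0, ENNReal.ofReal (Real.exp (∑ i, u i)) := by
        refine lintegral_mono_set ?_
        rintro _ ⟨x, hx, rfl⟩ i _
        simpa [hT] using hSD x hx i
    _ = ∫⁻ u in Set.univ.pi fun _ : Fin n => Set.Iic (0 : ℝ),
          ∏ i, ENNReal.ofReal (Real.exp (u i)) := by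
        simp_rw [Real.exp_sum]
        refine lintegral_congr fun u => ENNReal.ofReal_prod_of_nonneg fun i _ => (Real.exp_pos _).le
    _ = ∏ _i : Fin n, ∫⁻ u in Set.Iic (0 : ℝ), ENNReal.ofReal (Real.exp u) := by
        rw [volume_pi, Measure.restrict_pi_pi]
        exact lintegral_fin_prod_eq_prod _ fun _ =>
          ENNReal.measurable_ofReal.comp Real.measurable_exp
    _ ≤ 1 := by
        rw [← ofReal_integral_eq_lintegral_ofReal (integrableOn_exp_Iic 0)
          (Filter.Eventually.of_forall fun x => (Real.exp_pos x).le), integral_exp_Iic_zero]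
        simp

theorem contDiff_sysF {n : ℕ} (A : Fin n → Finset (EuclideanSpace ℝ (Fin n))) :
    ContDiff ℝ 1 fun p : (∀ i, A i → ℝ) × EuclideanSpace ℝ (Fin n) => sysF A p.1 p.2 := by
  refine contDiff_pi.2 fun i => ContDiff.sum fun a _ => ContDiff.mul ?_ ?_
  · exact contDiff_pi.1 (contDiff_pi.1 contDiff_fst i) a
  · exact (contDiff_const.inner ℝ contDiff_snd).exp

/-- The closed cone of all `w` such that `⟪·, w⟫` is maximal over `A i` at `v i` for every `i`. -/
def maxCone {n : ℕ} {A : Fin n → Finset (EuclideanSpace ℝ (Fin n))} (v : ∀ i, A i) :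
    Set (EuclideanSpace ℝ (Fin n)) :=
  {w | ∀ i, ∀ a : A i, ⟪(a : EuclideanSpace ℝ (Fin n)) - v i, w⟫ ≤ 0}

theorem isClosed_maxCone {n : ℕ} {A : Fin n → Finset (EuclideanSpace ℝ (Fin n))}
    (v : ∀ i, A i) : IsClosed (maxCone v) := by
  simp only [maxCone, Set.ofPred_forall]
  exact isClosed_iInter fun i => isClosed_iInter fun a =>
    isClosed_le (by fun_prop) continuous_const

theorem measurable_encard_nondegZeros_inter {n : ℕ}
    (A : Fin n → Finset (EuclideanSpace ℝ (Fin n))) {C : Set (EuclideanSpace ℝ (Fin n))}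
    (hC : MeasurableSet C) :
    Measurable fun c => (((nondegZeros A c ∩ C).encard : ℕ∞) : ℝ≥0∞) := by
  have hF := contDiff_sysF A
  have hFd : Continuous fun p : (∀ i, A i → ℝ) × EuclideanSpace ℝ (Fin n) =>
      fderiv ℝ (sysF A p.1) p.2 :=
    (ContDiff.fderiv (n := 0) (m := 1)
      (f := fun (p : (∀ i, A i → ℝ) × EuclideanSpace ℝ (Fin n)) => sysF A p.1)
      (hF.comp (by fun_prop : ContDiff ℝ 1
        fun q : ((∀ i, A i → ℝ) × EuclideanSpace ℝ (Fin n)) × EuclideanSpace ℝ (Fin n) =>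
          (q.1.1, q.2))) contDiff_snd (by simp)).continuous
  let T : Set ((∀ i, A i → ℝ) × EuclideanSpace ℝ (Fin n)) :=
    {p | Function.Bijective (fderiv ℝ (sysF A p.1) p.2) ∧ p.2 ∈ C}
  have hT : MeasurableSet T := by
    have hopen := (ContinuousLinearEquiv.isOpen (𝕜 := ℝ) (E := EuclideanSpace ℝ (Fin n))
      (F := Fin n → ℝ)).preimage hFd
    convert hopen.measurableSet.inter (measurable_snd hC) using 1
    ext p
    refine and_congr_left fun _ => ⟨fun h => ?_, ?_⟩
    · exact ⟨(LinearEquiv.ofBijective (fderiv ℝ (sysF A p.1) p.2 :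
        EuclideanSpace ℝ (Fin n) →ₗ[ℝ] (Fin n → ℝ)) h).toContinuousLinearEquiv, by ext; rfl⟩
    · rintro ⟨e, he⟩
      rw [← show _ = fderiv ℝ (sysF A p.1) p.2 from he]
      exact e.bijective
  have hloc : ∀ p ∈ T, ∃ U ∈ nhds p, Set.InjOn (fun q => (q.1, sysF A q.1 q.2)) U := by
    intro p hp
    have hs := hF.contDiffAt.hasStrictFDerivAt (x := p) (by simp)
    refine ((hasStrictFDerivAt_fst (𝕜 := ℝ) (p := p)).prodMk hs).exists_mem_nhds_injOn ?_
    refine (injective_iff_map_eq_zero _).2 fun u hu => ?_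
    obtain ⟨hu1, hu2⟩ := Prod.ext_iff.1 hu
    have hcomp : fderiv ℝ (sysF A p.1) p.2 =
        (fderiv ℝ (fun q : (∀ i, A i → ℝ) × EuclideanSpace ℝ (Fin n) => sysF A q.1 q.2) p).comp
          (ContinuousLinearMap.inr ℝ _ _) :=
      HasFDerivAt.fderiv (HasFDerivAt.comp (x := p.2) (f := fun w => (p.1, w))
        (g := fun q : (∀ i, A i → ℝ) × EuclideanSpace ℝ (Fin n) => sysF A q.1 q.2)
        hs.hasFDerivAt (hasFDerivAt_prodMk_right p.1 p.2))
    have hu1' : u.1 = 0 := hu1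
    have h0 : fderiv ℝ (sysF A p.1) p.2 u.2 = 0 := by
      rw [hcomp]
      have : u = ContinuousLinearMap.inr ℝ (∀ i, A i → ℝ) (EuclideanSpace ℝ (Fin n)) u.2 :=
        Prod.ext hu1' rfl
      rw [ContinuousLinearMap.comp_apply, ← this]
      exact hu2
    exact Prod.ext hu1' (hp.1.1 (h0.trans (map_zero _).symm))
  have key := measurable_encard_fiber (continuous_fst.prodMk hF.continuous) hT hloc
  convert key.comp (measurable_id.prodMk measurable_const : Measurable
    fun c : ∀ i, A i → ℝ => (c, (0 : Fin n → ℝ))) using 1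
  funext c
  have hinj : Function.Injective fun w : EuclideanSpace ℝ (Fin n) => (c, w) :=
    fun _ _ h => (Prod.ext_iff.1 h).2
  simp only [Function.comp_apply, id_eq]
  rw [← hinj.encard_image]
  congr 2
  ext ⟨c', w⟩
  simp only [nondegZeros, Set.mem_image, T]
  constructor
  · rintro ⟨w', ⟨⟨h4, h1⟩, h2⟩, h3⟩
    obtain ⟨rfl, rfl⟩ := Prod.ext_iff.1 h3
    exact ⟨⟨h1, h2⟩, Prod.ext rfl h4⟩
  · rintro ⟨⟨h1, h2⟩, h3⟩
    obtain ⟨rfl, h4⟩ := Prod.ext_iff.1 h3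
    exact ⟨w, ⟨⟨h4, h1⟩, h2⟩, rfl⟩

theorem inner_toLp_eq_sum {n : ℕ} (a : EuclideanSpace ℝ (Fin n)) (x : Fin n → ℝ) :
    ⟪a, WithLp.toLp 2 x⟫ = ∑ j, a j * x j := by
  simp [PiLp.inner_apply, mul_comm]

/-- The values which the coefficients `c i (v i)` must take for `x` to be a common zero. -/
def solvedCoeff {n : ℕ} {A : Fin n → Finset (EuclideanSpace ℝ (Fin n))} (v : ∀ i, A i)
    (c : ∀ i, A i → ℝ) (x : Fin n → ℝ) : Fin n → ℝ :=
  fun i => ∑ a ∈ Finset.univ.erase (v i), -c i a * Real.exp (∑ j, (a.1 j - (v i).1 j) * x j)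

/-- The Jacobian matrix of `solvedCoeff v c` at `x`. -/
def solvedJacobian {n : ℕ} {A : Fin n → Finset (EuclideanSpace ℝ (Fin n))} (v : ∀ i, A i)
    (c : ∀ i, A i → ℝ) (x : Fin n → ℝ) : Matrix (Fin n) (Fin n) ℝ :=
  fun i => ∑ a ∈ Finset.univ.erase (v i),
    (-c i a * Real.exp (∑ j, (a.1 j - (v i).1 j) * x j)) • fun j => a.1 j - (v i).1 j

theorem contDiff_solvedCoeff {n : ℕ} {A : Fin n → Finset (EuclideanSpace ℝ (Fin n))}
    (v : ∀ i, A i) (c : ∀ i, A i → ℝ) : ContDiff ℝ 1 (solvedCoeff v c) := by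
  unfold solvedCoeff
  fun_prop

theorem hasFDerivAt_solvedCoeff {n : ℕ} {A : Fin n → Finset (EuclideanSpace ℝ (Fin n))}
    (v : ∀ i, A i) (c : ∀ i, A i → ℝ) (x : Fin n → ℝ) :
    HasFDerivAt (solvedCoeff v c)
      (LinearMap.toContinuousLinearMap (Matrix.toLin' (solvedJacobian v c x))) x := by
  refine hasFDerivAt_pi'' fun i => ?_
  have hterm : ∀ a : A i, HasFDerivAt
      (fun x : Fin n → ℝ => -c i a * Real.exp (∑ j, (a.1 j - (v i).1 j) * x j))
      ((-c i a) • (Real.exp (∑ j, (a.1 j - (v i).1 j) * x j) •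
        ∑ j, (a.1 j - (v i).1 j) • ContinuousLinearMap.proj (R := ℝ) (φ := fun _ : Fin n => ℝ) j))
      x := by
    intro a
    refine HasFDerivAt.const_mul (HasFDerivAt.exp (HasFDerivAt.fun_sum fun j _ => ?_)) _
    exact (hasFDerivAt_apply j x).const_mul _
  refine (HasFDerivAt.fun_sum fun a (_ : a ∈ Finset.univ.erase (v i)) => hterm a).congr_fderiv ?_
  refine ContinuousLinearMap.ext fun u => ?_
  simp only [ContinuousLinearMap.comp_apply, ContinuousLinearMap.proj_apply,
    LinearMap.coe_toContinuousLinearMap', Matrix.toLin'_apply, Matrix.mulVec, solvedJacobian,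
    dotProduct, Finset.sum_apply, Pi.smul_apply, sum_apply,
    smul_apply, smul_eq_mul, Finset.sum_mul, Finset.mul_sum]
  rw [Finset.sum_comm]
  exact Finset.sum_congr rfl fun j _ => Finset.sum_congr rfl fun a _ => by ring

theorem sysF_update {n : ℕ} {A : Fin n → Finset (EuclideanSpace ℝ (Fin n))}
    (v : ∀ i, A i) (c : ∀ i, A i → ℝ) (y x : Fin n → ℝ) (i : Fin n) :
    sysF A (fun i => Function.update (c i) (v i) (y i)) (WithLp.toLp 2 x) i =
      Real.exp (∑ j, (v i).1 j * x j) * (y i - solvedCoeff v c x i) := by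
  rw [sysF, Fexp, ← Finset.add_sum_erase _ _ (Finset.mem_univ (v i)), solvedCoeff, mul_sub,
    Function.update_self, inner_toLp_eq_sum, mul_comm (y i), sub_eq_add_neg, Finset.mul_sum,
    ← Finset.sum_neg_distrib]
  congr 1
  refine Finset.sum_congr rfl fun a ha => ?_
  rw [Function.update_of_ne (Finset.ne_of_mem_erase ha), inner_toLp_eq_sum]
  have : ∑ j, a.1 j * x j = ∑ j, (v i).1 j * x j + ∑ j, (a.1 j - (v i).1 j) * x j := by
    rw [← Finset.sum_add_distrib]
    exact Finset.sum_congr rfl fun j _ => by ring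
  rw [this, Real.exp_add]
  ring

theorem solvedCoeff_of_mem_nondegZeros {n : ℕ} {A : Fin n → Finset (EuclideanSpace ℝ (Fin n))}
    {v : ∀ i, A i} {c : ∀ i, A i → ℝ} {y x : Fin n → ℝ}
    (h : WithLp.toLp 2 x ∈ nondegZeros A fun i => Function.update (c i) (v i) (y i)) :
    solvedCoeff v c x = y ∧ Function.Injective (fderiv ℝ (solvedCoeff v c) x) := by
  set c' := fun i => Function.update (c i) (v i) (y i) with hc'
  obtain ⟨hzero, hbij⟩ := h
  have hy : solvedCoeff v c x = y := by
    funext i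
    have := congrFun hzero i
    rw [sysF_update] at this
    have := (mul_eq_zero.1 this).resolve_left (Real.exp_pos _).ne'
    linarith
  refine ⟨hy, (injective_iff_map_eq_zero _).2 fun u hu => ?_⟩
  have hdiff : DifferentiableAt ℝ (sysF A c') (WithLp.toLp 2 x) :=
    ((contDiff_sysF A).comp (contDiff_prodMk_right c')).differentiable (by simp) _
  let e := (EuclideanSpace.equiv (Fin n) ℝ).symm
  have h1 : HasFDerivAt (fun x : Fin n → ℝ => sysF A c' (WithLp.toLp 2 x))
      ((fderiv ℝ (sysF A c') (WithLp.toLp 2 x)).comp (e : (Fin n → ℝ) →L[ℝ] _)) x :=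
    HasFDerivAt.comp x (f := fun x : Fin n → ℝ => WithLp.toLp 2 x) hdiff.hasFDerivAt
      e.hasFDerivAt
  have hs := (contDiff_solvedCoeff v c).differentiable (by simp) x |>.hasFDerivAt
  have h2 : fderiv ℝ (sysF A c') (WithLp.toLp 2 x) (e u) = 0 := by
    funext i
    have h3 := (hasFDerivAt_pi'.1 h1) i
    have hE : DifferentiableAt ℝ (fun x : Fin n → ℝ => Real.exp (∑ j, (v i).1 j * x j)) x := by
      fun_prop
    have h4 := hE.hasFDerivAt.mul ((hasFDerivAt_pi'.1 hs i).const_sub (y i))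
    have h5 := h3.unique (h4.congr_of_eventuallyEq
      (Filter.Eventually.of_forall fun z => sysF_update v c y z i))
    have h6 := DFunLike.congr_fun h5 u
    have h7 : y i - solvedCoeff v c x i = 0 := by rw [hy, sub_self]
    simpa [hu, h7] using h6
  exact (map_eq_zero_iff e e.injective).1 (hbij.1 (h2.trans (map_zero _).symm))

theorem abs_det_solvedJacobian_le {n : ℕ} {A : Fin n → Finset (EuclideanSpace ℝ (Fin n))}
    (v : ∀ i, A i) (c : ∀ i, A i → ℝ) (x : Fin n → ℝ) :
    |(solvedJacobian v c x).det| ≤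
      ∑ r ∈ Fintype.piFinset fun i => Finset.univ.erase (v i), (∏ i, |c i (r i)|) *
        (|(Matrix.of fun i j => (r i).1 j - (v i).1 j).det| *
          Real.exp (∑ i, (Matrix.of fun i j => (r i).1 j - (v i).1 j).mulVec x i)) := by
  have hexp : (solvedJacobian v c x).det =
      ∑ r ∈ Fintype.piFinset fun i => Finset.univ.erase (v i),
        (∏ i, (-c i (r i) * Real.exp (∑ j, ((r i).1 j - (v i).1 j) * x j))) *
          (Matrix.of fun i j => (r i).1 j - (v i).1 j).det := by
    refine ((Matrix.detRowAlternating (R := ℝ) (n := Fin n)).toMultilinearMap.map_sum_finset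
      (fun i (a : A i) => (-c i a * Real.exp (∑ j, (a.1 j - (v i).1 j) * x j)) •
        fun j => a.1 j - (v i).1 j) fun i => Finset.univ.erase (v i)).trans ?_
    refine Finset.sum_congr rfl fun r _ => ?_
    exact MultilinearMap.map_smul_univ _ _ _
  rw [hexp]
  refine (Finset.abs_sum_le_sum_abs _ _).trans (Finset.sum_le_sum fun r _ => le_of_eq ?_)
  rw [abs_mul, Finset.abs_prod, Real.exp_sum]
  simp_rw [abs_mul, abs_neg, Real.abs_exp, Finset.prod_mul_distrib]
  simp only [Matrix.mulVec, dotProduct, Matrix.of_apply]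
  ring

theorem lintegral_prod_abs_coeffMeasure_le_one {n : ℕ}
    (A : Fin n → Finset (EuclideanSpace ℝ (Fin n))) (r : ∀ i, A i) :
    ∫⁻ c, ∏ i, ENNReal.ofReal |c i (r i)| ∂(coeffMeasure A) ≤ 1 := by
  have hm : Measurable fun x : ℝ => ENNReal.ofReal |x| := by fun_prop
  rw [coeffMeasure, lintegral_fin_prod_eq_prod (fun i => Measure.pi fun _ : A i => gaussianReal 0 1)
    (f := fun i (c : A i → ℝ) => ENNReal.ofReal |c (r i)|)
    fun i => hm.comp (measurable_pi_apply (r i))]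
  refine Finset.prod_le_one' fun i _ => ?_
  have := (measurePreserving_eval (fun _ : A i => gaussianReal 0 1) (r i)).lintegral_comp hm
  exact this.trans_le lintegral_abs_gaussianReal_le_one

theorem lintegral_abs_det_solvedJacobian_le {n : ℕ}
    {A : Fin n → Finset (EuclideanSpace ℝ (Fin n))} (v : ∀ i, A i) :
    ∫⁻ c, (∫⁻ x in {x | WithLp.toLp 2 x ∈ maxCone v},
        ENNReal.ofReal |(solvedJacobian v c x).det|) ∂(coeffMeasure A) ≤
      ∏ i, (((A i).card - 1 : ℕ) : ℝ≥0∞) := by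
  set S : Set (Fin n → ℝ) := {x | WithLp.toLp 2 x ∈ maxCone v}
  have hS : MeasurableSet S :=
    ((isClosed_maxCone v).preimage (PiLp.continuous_toLp 2 fun _ : Fin n => ℝ)).measurableSet
  let R := Fintype.piFinset fun i => Finset.univ.erase (v i)
  let D : (∀ i, A i) → Matrix (Fin n) (Fin n) ℝ :=
    fun r => Matrix.of fun i j => (r i).1 j - (v i).1 j
  have hinner : ∀ r, ∫⁻ x in S, ENNReal.ofReal |(D r).det| *
      ENNReal.ofReal (Real.exp (∑ i, (D r).mulVec x i)) ≤ 1 := fun r =>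
    lintegral_abs_det_mul_exp_le_one (D r) hS fun x hx i => by
      have h : WithLp.toLp 2 x ∈ maxCone v := hx
      have h := h i (r i)
      rwa [inner_toLp_eq_sum] at h
  calc ∫⁻ c, (∫⁻ x in S, ENNReal.ofReal |(solvedJacobian v c x).det|) ∂(coeffMeasure A)
      ≤ ∫⁻ c, ∑ r ∈ R, ∏ i, ENNReal.ofReal |c i (r i)| ∂(coeffMeasure A) := by
        refine lintegral_mono fun c => ?_
        calc ∫⁻ x in S, ENNReal.ofReal |(solvedJacobian v c x).det|
            ≤ ∫⁻ x in S, ∑ r ∈ R, (∏ i, ENNReal.ofReal |c i (r i)|) *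
                (ENNReal.ofReal |(D r).det| *
                  ENNReal.ofReal (Real.exp (∑ i, (D r).mulVec x i))) := by
              refine lintegral_mono fun x => ?_
              refine (ENNReal.ofReal_le_ofReal (abs_det_solvedJacobian_le v c x)).trans_eq ?_
              rw [ENNReal.ofReal_sum_of_nonneg fun r _ => by positivity]
              refine Finset.sum_congr rfl fun r _ => ?_
              rw [ENNReal.ofReal_mul (by positivity), ENNReal.ofReal_mul (by positivity),
                ENNReal.ofReal_prod_of_nonneg fun i _ => abs_nonneg _]
          _ = ∑ r ∈ R, (∏ i, ENNReal.ofReal |c i (r i)|) *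
                ∫⁻ x in S, ENNReal.ofReal |(D r).det| *
                  ENNReal.ofReal (Real.exp (∑ i, (D r).mulVec x i)) := by
              have hm : ∀ r, Measurable fun x : Fin n → ℝ => ENNReal.ofReal |(D r).det| *
                  ENNReal.ofReal (Real.exp (∑ i, (D r).mulVec x i)) := by
                intro r
                simp only [Matrix.mulVec, dotProduct]
                fun_prop
              rw [lintegral_finsetSum _ fun r _ => (hm r).const_mul _]
              exact Finset.sum_congr rfl fun r _ => lintegral_const_mul _ (hm r)
          _ ≤ ∑ r ∈ R, ∏ i, ENNReal.ofReal |c i (r i)| :=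
              Finset.sum_le_sum fun r _ => mul_le_of_le_one_right' (hinner r)
    _ = ∑ r ∈ R, ∫⁻ c, ∏ i, ENNReal.ofReal |c i (r i)| ∂(coeffMeasure A) :=
        lintegral_finsetSum _ fun r _ => by fun_prop
    _ ≤ ∑ r ∈ R, 1 :=
        Finset.sum_le_sum fun r _ => lintegral_prod_abs_coeffMeasure_le_one A r
    _ = ∏ i, (((A i).card - 1 : ℕ) : ℝ≥0∞) := by
        simp [R, Fintype.card_piFinset, Finset.card_erase_of_mem]

/-- The expected number of nondegenerate zeros in a maximality cone. -/
theorem lintegral_encard_nondegZeros_inter_maxCone_le {n : ℕ}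
    {A : Fin n → Finset (EuclideanSpace ℝ (Fin n))} (v : ∀ i, A i) :
    ∫⁻ c, (((nondegZeros A c ∩ maxCone v).encard : ℕ∞) : ℝ≥0∞) ∂(coeffMeasure A) ≤
      ENNReal.ofReal ((2 * Real.pi) ^ (-(n : ℝ) / 2)) *
        ∏ i, (((A i).card - 1 : ℕ) : ℝ≥0∞) := by
  set k := ENNReal.ofReal ((2 * Real.pi) ^ (-(n : ℝ) / 2))
  set S : Set (Fin n → ℝ) := {x | WithLp.toLp 2 x ∈ maxCone v}
  have hS : MeasurableSet S :=
    ((isClosed_maxCone v).preimage (PiLp.continuous_toLp 2 fun _ : Fin n => ℝ)).measurableSet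
  have hcount : ∀ c y, (((nondegZeros A (fun i => Function.update (c i) (v i) (y i)) ∩
      maxCone v).encard : ℕ∞) : ℝ≥0∞) ≤
      (({x | x ∈ {x ∈ S | Function.Injective (fderiv ℝ (solvedCoeff v c) x)} ∧
        solvedCoeff v c x = y}.encard : ℕ∞) : ℝ≥0∞) := by
    intro c y
    rw [← (WithLp.toLp_injective 2 (V := Fin n → ℝ)).encard_image]
    refine ENat.toENNReal_mono (Set.encard_le_encard ?_)
    rintro w ⟨hw, hwv⟩
    have h := solvedCoeff_of_mem_nondegZeros (x := WithLp.ofLp w) hw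
    exact ⟨WithLp.ofLp w, ⟨⟨hwv, h.2⟩, h.1⟩, rfl⟩
  have hmp := measurePreserving_pi_update (gaussianReal 0 1) v
  have hdet : ∀ c x, (fderiv ℝ (solvedCoeff v c) x).det = (solvedJacobian v c x).det := by
    intro c x
    rw [(hasFDerivAt_solvedCoeff v c x).fderiv]
    simp [ContinuousLinearMap.det]
  have harea : ∀ c, ∫⁻ y, (({x | x ∈ {x ∈ S | Function.Injective
      (fderiv ℝ (solvedCoeff v c) x)} ∧ solvedCoeff v c x = y}.encard : ℕ∞) : ℝ≥0∞) ≤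
      ∫⁻ x in S, ENNReal.ofReal |(solvedJacobian v c x).det| := by
    intro c
    have hinj : ∀ x, Function.Injective (fderiv ℝ (solvedCoeff v c) x) ↔
        (fderiv ℝ (solvedCoeff v c) x).det ≠ 0 := by
      intro x
      rw [ContinuousLinearMap.det, ← isUnit_iff_ne_zero, ← LinearMap.isUnit_iff_isUnit_det,
        LinearMap.isUnit_iff_ker_eq_bot, LinearMap.ker_eq_bot]
      rfl
    have hmeas : MeasurableSet {x ∈ S | Function.Injective (fderiv ℝ (solvedCoeff v c) x)} := by
      simp_rw [hinj]
      refine hS.inter (IsOpen.measurableSet (isOpen_ne_fun ?_ continuous_const))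
      exact ContinuousLinearMap.continuous_det.comp
        ((contDiff_solvedCoeff v c).continuous_fderiv (by simp))
    rw [lintegral_encard_fiber_eq volume (contDiff_solvedCoeff v c) hmeas fun x hx => hx.2]
    simp_rw [hdet]
    exact lintegral_mono_set fun x hx => hx.1
  rw [coeffMeasure, ← hmp.lintegral_comp
    (measurable_encard_nondegZeros_inter A (isClosed_maxCone v).measurableSet)]
  calc _ ≤ ∫⁻ c, ∫⁻ y, _ ∂(Measure.pi fun _ : Fin n => gaussianReal 0 1) ∂(coeffMeasure A) :=
        lintegral_prod_le _
    _ ≤ ∫⁻ c, k * (∫⁻ x in S, ENNReal.ofReal |(solvedJacobian v c x).det|) ∂(coeffMeasure A) := by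
        refine lintegral_mono fun c => ?_
        refine (lintegral_mono (hcount c)).trans ?_
        refine (lintegral_mono' (pi_gaussianReal_le n) le_rfl).trans ?_
        rw [lintegral_smul_measure]
        exact mul_le_mul_right (harea c) k
    _ ≤ _ := by
        rw [lintegral_const_mul' _ _ ENNReal.ofReal_ne_top]
        exact mul_le_mul_right (lintegral_abs_det_solvedJacobian_le v) k

theorem exists_extremePoint_forall_inner_le {E : Type*} [NormedAddCommGroup E]
    [InnerProductSpace ℝ E] {K : Set E} (hK : IsCompact K) (hne : K.Nonempty) (w : E) :
    ∃ x ∈ K.extremePoints ℝ, ∀ y ∈ K, ⟪y, w⟫ ≤ ⟪x, w⟫ := by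
  have hexp : IsExposed ℝ K ((innerSL ℝ w).toExposed K) :=
    ContinuousLinearMap.toExposed.isExposed
  obtain ⟨m, hm, hmax⟩ := hK.exists_isMaxOn hne (innerSL ℝ w).continuous.continuousOn
  obtain ⟨x, hx⟩ := (hexp.isCompact hK).extremePoints_nonempty ⟨m, hm, hmax⟩
  refine ⟨x, hexp.isExtreme.extremePoints_subset_extremePoints hx, fun y hy => ?_⟩
  have := hx.1.2 y hy
  simpa [real_inner_comm] using this

/-- Every vertex of a Minkowski sum of polytopes is a sum of points of the spanning sets. -/
theorem exists_sum_eq_of_mem_extremePoints {n : ℕ}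
    {A : Fin n → Finset (EuclideanSpace ℝ (Fin n))} {x : EuclideanSpace ℝ (Fin n)}
    (hx : x ∈ Set.extremePoints ℝ
      (∑ i, convexHull ℝ (A i : Set (EuclideanSpace ℝ (Fin n))))) :
    ∃ v : ∀ i, A i, ∑ i, (v i : EuclideanSpace ℝ (Fin n)) = x := by
  rw [← convexHull_sum] at hx
  obtain ⟨g, hg, rfl⟩ := (Set.mem_fintype_sum _ _).1 (extremePoints_convexHull_subset hx)
  exact ⟨fun i => ⟨g i, hg i⟩, rfl⟩

theorem mem_maxCone_of_forall_inner_le {n : ℕ}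
    {A : Fin n → Finset (EuclideanSpace ℝ (Fin n))} {v : ∀ i, A i}
    {w : EuclideanSpace ℝ (Fin n)}
    (h : ∀ y ∈ ∑ i, convexHull ℝ (A i : Set (EuclideanSpace ℝ (Fin n))),
      ⟪y, w⟫ ≤ ⟪∑ i, (v i : EuclideanSpace ℝ (Fin n)), w⟫) : w ∈ maxCone v := by
  intro i a
  have hy : ∑ j, (Function.update v i a j : EuclideanSpace ℝ (Fin n)) ∈
      ∑ i, convexHull ℝ (A i : Set (EuclideanSpace ℝ (Fin n))) :=
    (Set.mem_fintype_sum _ _).2 ⟨_, fun j => subset_convexHull ℝ _ (Function.update v i a j).2, rfl⟩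
  have h := h _ hy
  have hcongr : ∑ j ∈ Finset.univ.erase i,
      (Function.update v i a j : EuclideanSpace ℝ (Fin n)) =
      ∑ j ∈ Finset.univ.erase i, (v j : EuclideanSpace ℝ (Fin n)) :=
    Finset.sum_congr rfl fun j hj => by
      rw [Function.update_of_ne (Finset.ne_of_mem_erase hj)]
  rw [← Finset.add_sum_erase _ _ (Finset.mem_univ i), hcongr, Function.update_self,
    ← Finset.add_sum_erase _ (fun j => (v j : EuclideanSpace ℝ (Fin n))) (Finset.mem_univ i),
    inner_add_left, inner_add_left] at h
  rw [inner_sub_left]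
  linarith

/-- Theorem 1.1: `E(A_1,…,A_n) ≤ (2π)^{-n/2} · V_0 · (t_1-1)⋯(t_n-1)`, where `V_0` is the
number of vertices of the Minkowski sum of the Newton polytopes. -/
theorem main_mixed_real {n : ℕ} (hn : 1 ≤ n)
    (A : Fin n → Finset (EuclideanSpace ℝ (Fin n))) (hA : ∀ i, (A i).Nonempty)
    (t : Fin n → ℕ) (ht : ∀ i, t i = (A i).card)
    (P : Fin n → Set (EuclideanSpace ℝ (Fin n)))
    (hP : ∀ i, P i = convexHull ℝ (A i : Set (EuclideanSpace ℝ (Fin n))))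
    (V₀ : ℕ) (hV₀ : V₀ = (Set.extremePoints ℝ (∑ i, P i)).ncard) :
    EE A ≤ ENNReal.ofReal
      ((2 * Real.pi) ^ (-(n : ℝ) / 2) * V₀ * ∏ i, ((t i : ℝ) - 1)) := by
  subst hV₀
  obtain rfl : P = fun i => convexHull ℝ (A i : Set (EuclideanSpace ℝ (Fin n))) := funext hP
  obtain rfl : t = fun i => (A i).card := funext ht
  set K := ∑ i, convexHull ℝ (A i : Set (EuclideanSpace ℝ (Fin n)))
  have hKhull : K = convexHull ℝ (∑ i, (A i : Set (EuclideanSpace ℝ (Fin n)))) :=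
    (convexHull_sum _ _).symm
  have hfin : (∑ i, (A i : Set (EuclideanSpace ℝ (Fin n)))).Finite := by
    rw [← Finset.coe_sum]
    exact Finset.finite_toSet _
  have hKcompact : IsCompact K := hKhull ▸ hfin.isCompact_convexHull (𝕜 := ℝ)
  have hKne : K.Nonempty := by
    choose g hg using hA
    exact ⟨_, (Set.mem_fintype_sum _ _).2 ⟨g, fun i => subset_convexHull ℝ _ (hg i), rfl⟩⟩
  have hext : (K.extremePoints ℝ).Finite :=
    hfin.subset (hKhull ▸ extremePoints_convexHull_subset (𝕜 := ℝ))
  have : Nonempty (∀ i, A i) := ⟨fun i => ⟨_, (hA i).choose_spec⟩⟩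
  choose! v hv using fun x (hx : x ∈ K.extremePoints ℝ) => exists_sum_eq_of_mem_extremePoints hx
  have hcover : ∀ c, nondegZeros A c ⊆
      ⋃ x ∈ hext.toFinset, nondegZeros A c ∩ maxCone (v x) := by
    intro c w hw
    obtain ⟨x, hx, hmax⟩ := exists_extremePoint_forall_inner_le hKcompact hKne w
    refine Set.mem_biUnion (hext.mem_toFinset.2 hx) ⟨hw, mem_maxCone_of_forall_inner_le ?_⟩
    rwa [hv x hx]
  calc EE A ≤ ∫⁻ c, ∑ x ∈ hext.toFinset,
        (((nondegZeros A c ∩ maxCone (v x)).encard : ℕ∞) : ℝ≥0∞) ∂(coeffMeasure A) := by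
        refine lintegral_mono fun c => ?_
        have h := (Set.encard_le_encard (hcover c)).trans (Finset.set_encard_biUnion_le _ _)
        exact (ENat.toENNReal_mono h).trans_eq (map_sum ENat.toENNRealRingHom _ _)
    _ ≤ ∑ x ∈ hext.toFinset, ENNReal.ofReal ((2 * Real.pi) ^ (-(n : ℝ) / 2)) *
          ∏ i, (((A i).card - 1 : ℕ) : ℝ≥0∞) := by
        rw [lintegral_finsetSum _ fun x _ =>
          measurable_encard_nondegZeros_inter A (isClosed_maxCone (v x)).measurableSet]
        exact Finset.sum_le_sum fun x _ => lintegral_encard_nondegZeros_inter_maxCone_le (v x)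
    _ = _ := by
        have hcard : ∀ i, ((A i).card : ℝ) - 1 = ((A i).card - 1 : ℕ) := fun i => by
          rw [Nat.cast_sub (hA i).card_pos, Nat.cast_one]
        simp_rw [hcard]
        rw [Finset.sum_const, nsmul_eq_mul, Set.ncard_eq_toFinset_card _ hext,
          ENNReal.ofReal_mul (by positivity), ENNReal.ofReal_mul (by positivity),
          ENNReal.ofReal_prod_of_nonneg fun i _ => Nat.cast_nonneg _]
        simp_rw [ENNReal.ofReal_natCast]
        ring

end
end

section
/- Let A ⊆ ℝ^n be a finite set of cardinality t ≥ 1 whose convex hull P has V_0 vertices (extreme points). Then E(A,…,A) ≤ vol(ℙ^n)^{−1} · V_0 · C(t−1, n), where C(t−1,n) is the binomial coefficient and vol(ℙ^n)^{−1} = Γ((n+1)/2) · π^{−(n+1)/2}. -/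
open MeasureTheory ProbabilityTheory Pointwise
open scoped ENNReal RealInnerProductSpace

noncomputable section

theorem lintegral_pi_prod_eq_pow {X : Type*} [MeasurableSpace X] (μ : Measure X)
    [SigmaFinite μ] (n : ℕ) (f : Fin n → X → ℝ≥0∞) (hf : ∀ i, Measurable (f i)) :
    ∫⁻ x : Fin n → X, ∏ i, f i (x i) ∂(Measure.pi fun _ => μ) = ∏ i, ∫⁻ x, f i x ∂μ := by
  induction n with
  | zero => simp [lintegral_unique]
  | succ n ih =>
    have h := (measurePreserving_piFinSuccAbove (fun _ : Fin (n+1) => μ) 0).symm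
    rw [← h.lintegral_comp_emb (MeasurableEquiv.measurableEmbedding _)]
    simp_rw [MeasurableEquiv.piFinSuccAbove_symm_apply, Fin.insertNthEquiv,
      Fin.prod_univ_succ, Fin.insertNth_zero]
    simp only [Equiv.coe_fn_mk, Fin.cons_zero, Fin.cons_succ, cast_eq]
    rw [lintegral_prod_mul (f := f 0) (g := fun y : Fin n → X => ∏ i, f (Fin.succ i) (y i))
      (hf 0).aemeasurable
      (Finset.measurable_prod _ fun i _ => (hf i.succ).comp (measurable_pi_apply i)).aemeasurable]
    rw [ih _ fun i => hf _]

theorem pi_withDensity_eq {X : Type*} [MeasurableSpace X] (μ : Measure X) [SigmaFinite μ] (n : ℕ)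
    (f : X → ℝ≥0∞) (hf : Measurable f) [SigmaFinite (μ.withDensity f)] :
    Measure.pi (fun _ : Fin n => μ.withDensity f) =
      (Measure.pi fun _ : Fin n => μ).withDensity fun x => ∏ i, f (x i) := by
  refine Measure.pi_eq fun s hs => ?_
  rw [withDensity_apply _ (MeasurableSet.univ_pi hs), ← lintegral_indicator (MeasurableSet.univ_pi hs)]
  have : ∀ x : Fin n → X, (Set.univ.pi s).indicator (fun x => ∏ i, f (x i)) x =
      ∏ i, (s i).indicator f (x i) := by
    intro x
    classical
    by_cases hx : x ∈ Set.univ.pi s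
    · rw [Set.indicator_of_mem hx]
      refine Finset.prod_congr rfl fun i _ => ?_
      rw [Set.indicator_of_mem (hx i trivial)]
    · rw [Set.indicator_of_notMem hx]
      simp only [Set.mem_pi, Set.mem_univ, true_imp_iff, not_forall] at hx
      obtain ⟨i, hi⟩ := hx
      exact (Finset.prod_eq_zero (Finset.mem_univ i) (by simp [hi])).symm
  simp_rw [this]
  rw [lintegral_pi_prod_eq_pow μ n _ fun i => hf.indicator (hs i)]
  refine Finset.prod_congr rfl fun i _ => ?_
  rw [withDensity_apply _ (hs i), lintegral_indicator (hs i)]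

theorem factorial_mul_det_mul {ι : Type*} [Fintype ι] [DecidableEq ι] {n : ℕ}
    (C : Matrix (Fin n) ι ℝ) (M : Matrix ι (Fin n) ℝ) :
    (n.factorial : ℝ) * (C * M).det =
      ∑ f : Fin n ↪ ι, (C.submatrix id f).det * (M.submatrix f id).det := by
  have h1 : (C * M).det = ∑ f : Fin n → ι, (∏ i, C i (f i)) * (M.submatrix f id).det := by
    have := (Matrix.detRowAlternating (n := Fin n) (R := ℝ)).toMultilinearMap.map_sum
      (fun i (k : ι) => C i k • M k)
    have h2 : (C * M).det =
        (Matrix.detRowAlternating (n := Fin n) (R := ℝ)).toMultilinearMap (fun i => ∑ k, C i k • M k) := by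
      change _ = Matrix.det (fun i => ∑ k, C i k • M k)
      congr 1
      ext i j
      simp [Matrix.mul_apply]
    rw [h2, this]
    refine Finset.sum_congr rfl fun f _ => ?_
    rw [MultilinearMap.map_smul_univ]
    rfl
  have h3 : ∀ σ : Equiv.Perm (Fin n), (C * M).det =
      ∑ f : Fin n → ι, (σ.sign : ℝ) * (∏ i, C (σ i) (f i)) * (M.submatrix f id).det := by
    intro σ
    rw [h1]
    rw [← (Equiv.arrowCongr σ (Equiv.refl ι)).sum_comp]
    refine Finset.sum_congr rfl fun f _ => ?_
    have : M.submatrix ((σ.arrowCongr (Equiv.refl ι)) f) id =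
        (M.submatrix f id).submatrix σ.symm id := by
      ext; simp [Equiv.arrowCongr]
    rw [this, Matrix.det_permute, ← Equiv.prod_comp σ]
    simp [Equiv.arrowCongr, Equiv.Perm.sign_symm]
    ring
  have h4 : (n.factorial : ℝ) * (C * M).det =
      ∑ f : Fin n → ι, (C.submatrix id f).det * (M.submatrix f id).det := by
    have : (n.factorial : ℝ) * (C * M).det = ∑ σ : Equiv.Perm (Fin n), (C * M).det := by
      simp [Fintype.card_perm]
    rw [this, Finset.sum_congr rfl fun σ _ => h3 σ, Finset.sum_comm]
    refine Finset.sum_congr rfl fun f _ => ?_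
    rw [← Finset.sum_mul, Matrix.det_apply' (C.submatrix id f)]
    rfl
  rw [h4]
  symm
  refine Finset.sum_of_injOn (fun f : Fin n ↪ ι => (f : Fin n → ι))
    DFunLike.coe_injective.injOn (by simp) ?_ (by simp)
  intro f _ hf
  have : ¬ Function.Injective f := fun h => hf ⟨⟨f, h⟩, by simp⟩
  simp only [Function.Injective, not_forall] at this
  obtain ⟨i, j, hij, hne⟩ := this
  rw [Matrix.det_zero_of_row_eq hne (M := M.submatrix f id) (by ext; simp [hij]), mul_zero]

theorem lintegral_rpow_mul_exp_neg_mul_Ioi {a r : ℝ} (ha : 0 < a) (hr : 0 < r) :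
    ∫⁻ t in Set.Ioi (0 : ℝ), ENNReal.ofReal (t ^ (a - 1) * Real.exp (-(r * t))) =
      ENNReal.ofReal ((1 / r) ^ a * Real.Gamma a) := by
  have hG := Real.Gamma_pos_of_pos ha
  rw [← Real.integral_rpow_mul_exp_neg_mul_Ioi ha hr, ofReal_integral_eq_lintegral_ofReal]
  · by_contra h
    have := integral_undef h
    rw [Real.integral_rpow_mul_exp_neg_mul_Ioi ha hr] at this
    have : 0 < (1 / r) ^ a * Real.Gamma a := by positivity
    linarith
  · refine (ae_restrict_mem measurableSet_Ioi).mono fun t ht => ?_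
    have : 0 < t := ht
    simp only [Pi.zero_apply]
    positivity

theorem lintegral_exp_neg_mul_dotProduct_self (n : ℕ) {t : ℝ} (ht : 0 < t) :
    ∫⁻ x : Fin n → ℝ, ENNReal.ofReal (Real.exp (-t * (x ⬝ᵥ x))) =
      ENNReal.ofReal (√(Real.pi / t) ^ n) := by
  have h1 : ∀ x : Fin n → ℝ, ENNReal.ofReal (Real.exp (-t * (x ⬝ᵥ x))) =
      ∏ i, ENNReal.ofReal (Real.exp (-t * x i ^ 2)) := by
    intro x
    rw [← ENNReal.ofReal_prod_of_nonneg fun _ _ => (Real.exp_pos _).le, ← Real.exp_sum]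
    simp [dotProduct, Finset.mul_sum, pow_two]
  simp_rw [h1]
  rw [volume_pi, lintegral_pi_prod_eq_pow volume n (fun i y => ENNReal.ofReal (Real.exp (-t * y ^ 2)))
      fun i => by fun_prop,
    ← ofReal_integral_eq_lintegral_ofReal (integrable_exp_neg_mul_sq ht)
      (.of_forall fun _ => (Real.exp_pos _).le), integral_gaussian]
  simp [ENNReal.ofReal_pow]

theorem lintegral_one_add_dotProduct_self_rpow (n : ℕ) :
    ∫⁻ x : Fin n → ℝ, ENNReal.ofReal ((1 + x ⬝ᵥ x) ^ (-((n + 1 : ℝ) / 2))) =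
      ENNReal.ofReal (Real.pi ^ ((n + 1 : ℝ) / 2) / Real.Gamma ((n + 1) / 2)) := by
  set p : ℝ := (n + 1) / 2 with hp
  have hp0 : 0 < p := by positivity
  have hG := Real.Gamma_pos_of_pos hp0
  have hr : ∀ x : Fin n → ℝ, 0 < 1 + x ⬝ᵥ x := fun x => by
    have : 0 ≤ x ⬝ᵥ x := Finset.sum_nonneg fun i _ => mul_self_nonneg _
    linarith
  have key : ENNReal.ofReal (Real.Gamma p) *
      ∫⁻ x : Fin n → ℝ, ENNReal.ofReal ((1 + x ⬝ᵥ x) ^ (-p)) =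
      ENNReal.ofReal (Real.pi ^ p) := by
    rw [← lintegral_const_mul _ (by unfold dotProduct; fun_prop)]
    have h1 : ∀ x : Fin n → ℝ,
        ENNReal.ofReal (Real.Gamma p) * ENNReal.ofReal ((1 + x ⬝ᵥ x) ^ (-p)) =
        ∫⁻ t in Set.Ioi (0 : ℝ), ENNReal.ofReal (t ^ (p - 1) * Real.exp (-((1 + x ⬝ᵥ x) * t))) := by
      intro x
      rw [lintegral_rpow_mul_exp_neg_mul_Ioi hp0 (hr x), ← ENNReal.ofReal_mul hG.le, mul_comm,
        Real.rpow_neg (hr x).le, one_div, Real.inv_rpow (hr x).le]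
    simp_rw [h1]
    rw [lintegral_lintegral_swap (by unfold dotProduct; fun_prop)]
    have h2 : ∀ t ∈ Set.Ioi (0 : ℝ),
        ∫⁻ x : Fin n → ℝ, ENNReal.ofReal (t ^ (p - 1) * Real.exp (-((1 + x ⬝ᵥ x) * t))) =
        ENNReal.ofReal (Real.pi ^ ((n : ℝ) / 2)) *
          ENNReal.ofReal (t ^ ((1 / 2 : ℝ) - 1) * Real.exp (-(1 * t))) := by
      intro t ht
      have ht : 0 < t := ht
      have h3 : ∀ x : Fin n → ℝ, ENNReal.ofReal (t ^ (p - 1) * Real.exp (-((1 + x ⬝ᵥ x) * t))) =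
          ENNReal.ofReal (t ^ (p - 1) * Real.exp (-t)) *
            ENNReal.ofReal (Real.exp (-t * (x ⬝ᵥ x))) := by
        intro x
        rw [← ENNReal.ofReal_mul (by positivity), mul_assoc, ← Real.exp_add]
        ring_nf
      simp_rw [h3]
      rw [lintegral_const_mul _ (by unfold dotProduct; fun_prop),
        lintegral_exp_neg_mul_dotProduct_self n ht, ← ENNReal.ofReal_mul (by positivity),
        ← ENNReal.ofReal_mul (by positivity)]
      congr 1
      have h4 : √(Real.pi / t) ^ n = Real.pi ^ ((n : ℝ) / 2) * t ^ (-((n : ℝ) / 2)) := by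
        rw [Real.sqrt_eq_rpow, ← Real.rpow_natCast, ← Real.rpow_mul (by positivity),
          Real.div_rpow Real.pi_pos.le ht.le, Real.rpow_neg ht.le, div_eq_mul_inv]
        ring_nf
      have h5 : t ^ ((1 / 2 : ℝ) - 1) = t ^ (p - 1) * t ^ (-((n : ℝ) / 2)) := by
        rw [← Real.rpow_add ht, hp]
        ring_nf
      rw [h4, h5, one_mul]
      ring
    rw [setLIntegral_congr_fun measurableSet_Ioi h2, lintegral_const_mul _ (by fun_prop),
      lintegral_rpow_mul_exp_neg_mul_Ioi (by norm_num) one_pos, ← ENNReal.ofReal_mul (by positivity)]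
    congr 1
    rw [Real.Gamma_one_half_eq, Real.sqrt_eq_rpow, div_one, Real.one_rpow, one_mul,
      ← Real.rpow_add Real.pi_pos, hp]
    ring_nf
  rw [ENNReal.ofReal_div_of_pos hG, ← key, mul_comm, ENNReal.mul_div_cancel_right]
  · simpa using hG
  · simp

theorem gaussianPDF_zero_one (x : ℝ) :
    gaussianPDF 0 1 x = ENNReal.ofReal ((√(2 * Real.pi))⁻¹ * Real.exp (-(x * x) / 2)) := by
  simp [gaussianPDF, gaussianPDFReal, pow_two]

theorem pi_gaussianReal_eq_withDensity (n : ℕ) :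
    Measure.pi (fun _ : Fin n => gaussianReal 0 1) = volume.withDensity fun x : Fin n → ℝ =>
      ENNReal.ofReal ((√(2 * Real.pi))⁻¹ ^ n * Real.exp (-(x ⬝ᵥ x) / 2)) := by
  rw [gaussianReal_of_var_ne_zero 0 one_ne_zero]
  have : SigmaFinite (volume.withDensity (gaussianPDF 0 1)) := by
    rw [← gaussianReal_of_var_ne_zero 0 one_ne_zero]; infer_instance
  rw [pi_withDensity_eq _ _ _ (measurable_gaussianPDF 0 1), ← volume_pi]
  congr 1
  ext x
  simp_rw [gaussianPDF_zero_one]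
  rw [← ENNReal.ofReal_prod_of_nonneg fun _ _ => by positivity, Finset.prod_mul_distrib,
    ← Real.exp_sum]
  simp [dotProduct, ← Finset.sum_div, Finset.sum_neg_distrib]

theorem pi_pi_gaussianReal_eq_withDensity (n : ℕ) :
    Measure.pi (fun _ : Fin n => Measure.pi (fun _ : Fin n => gaussianReal 0 1)) =
    volume.withDensity fun C : Fin n → Fin n → ℝ =>
      ENNReal.ofReal (((√(2 * Real.pi))⁻¹ ^ n) ^ n * Real.exp (-(∑ i, C i ⬝ᵥ C i) / 2)) := by
  rw [pi_gaussianReal_eq_withDensity]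
  have : SigmaFinite (volume.withDensity fun x : Fin n → ℝ =>
      ENNReal.ofReal ((√(2 * Real.pi))⁻¹ ^ n * Real.exp (-(x ⬝ᵥ x) / 2))) := by
    rw [← pi_gaussianReal_eq_withDensity]; infer_instance
  rw [pi_withDensity_eq _ _ _ (by unfold dotProduct; fun_prop), ← volume_pi]
  congr 1
  ext x
  rw [← ENNReal.ofReal_prod_of_nonneg fun _ _ => by positivity, Finset.prod_mul_distrib,
    ← Real.exp_sum]
  simp [← Finset.sum_div, Finset.sum_neg_distrib]

theorem measurable_det_fin (n : ℕ) :
    Measurable fun C : Fin n → Fin n → ℝ => (Matrix.of C).det := by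
  simp_rw [Matrix.det_apply]
  simp only [Matrix.of_apply]
  fun_prop

theorem lintegral_comp_linearMap {E : Type*} [NormedAddCommGroup E] [NormedSpace ℝ E]
    [MeasurableSpace E] [BorelSpace E] [FiniteDimensional ℝ E] (μ : Measure E)
    [μ.IsAddHaarMeasure] {L : E →ₗ[ℝ] E} (hL : LinearMap.det L ≠ 0) {f : E → ℝ≥0∞}
    (hf : Measurable f) :
    ENNReal.ofReal |LinearMap.det L| * ∫⁻ x, f (L x) ∂μ = ∫⁻ x, f x ∂μ := by
  rw [← lintegral_map hf (L.continuous_of_finiteDimensional.measurable),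
    Measure.map_linearMap_addHaar_eq_smul_addHaar μ hL, lintegral_smul_measure, smul_eq_mul,
    ← mul_assoc, ← ENNReal.ofReal_mul (abs_nonneg _), ← abs_mul, mul_inv_cancel₀ hL]
  simp

theorem lintegral_exp_mul_abs_det (n : ℕ) (x : Fin n → ℝ) :
    ∫⁻ C : Fin n → Fin n → ℝ, ENNReal.ofReal
      (Real.exp (-((Matrix.of C).mulVec x ⬝ᵥ (Matrix.of C).mulVec x) / 2) * |(Matrix.of C).det|)
      ∂(Measure.pi fun _ : Fin n => Measure.pi (fun _ : Fin n => gaussianReal 0 1)) =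
    ENNReal.ofReal ((1 + x ⬝ᵥ x) ^ (-((n + 1 : ℝ) / 2))) *
      ∫⁻ C : Fin n → Fin n → ℝ, ENNReal.ofReal |(Matrix.of C).det|
      ∂(Measure.pi fun _ : Fin n => Measure.pi (fun _ : Fin n => gaussianReal 0 1)) := by
  have hdet := measurable_det_fin n
  have hr : 0 ≤ x ⬝ᵥ x := Finset.sum_nonneg fun i _ => mul_self_nonneg _
  set s : ℝ := √(1 + x ⬝ᵥ x) with hs
  have hs0 : 0 < s := Real.sqrt_pos.2 (by linarith)
  have hss : x ⬝ᵥ x = s ^ 2 - 1 := by rw [hs, Real.sq_sqrt (by linarith)]; ring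
  set β : ℝ := 1 / (s * (1 + s)) with hβ
  have hs1 : 1 + s ≠ 0 := by positivity
  let T : Matrix (Fin n) (Fin n) ℝ := 1 - β • Matrix.vecMulVec x x
  have hT : ∀ c, T.mulVec c = c - (β * (x ⬝ᵥ c)) • x := by
    intro c
    simp [T, Matrix.sub_mulVec, Matrix.smul_mulVec, Matrix.vecMulVec_mulVec, mul_smul]
  have hTdet : T.det = s⁻¹ := by
    have : T = 1 + Matrix.replicateCol Unit ((-β) • x) * Matrix.replicateRow Unit x := by
      rw [← Matrix.vecMulVec_eq]
      simp [T, Matrix.smul_vecMulVec, sub_eq_add_neg]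
    rw [this, Matrix.det_one_add_replicateCol_mul_replicateRow, dotProduct_smul, hss, hβ, smul_eq_mul]
    field_simp
    ring
  let L : (Fin n → Fin n → ℝ) →ₗ[ℝ] (Fin n → Fin n → ℝ) :=
    LinearMap.pi fun i => (Matrix.toLin' T).comp (LinearMap.proj i)
  have hL : ∀ C i, L C i = T.mulVec (C i) := fun C i => rfl
  have hLdet : LinearMap.det L = (s⁻¹) ^ n := by
    simp only [L]
    rw [LinearMap.det_pi]
    simp [hTdet]
  have hLof : ∀ C, (Matrix.of (L C)).det = (Matrix.of C).det * s⁻¹ := by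
    intro C
    rw [← hTdet, ← Matrix.det_transpose T, ← Matrix.det_mul]
    congr 1
    ext i j
    simp only [Matrix.of_apply, hL, Matrix.mul_apply, Matrix.mulVec, dotProduct, Matrix.transpose_apply]
    exact Finset.sum_congr rfl fun k _ => mul_comm _ _
  have hquad : ∀ c : Fin n → ℝ, T.mulVec c ⬝ᵥ T.mulVec c + (T.mulVec c ⬝ᵥ x) * (T.mulVec c ⬝ᵥ x) =
      c ⬝ᵥ c := by
    intro c
    rw [hT]
    simp only [sub_dotProduct, dotProduct_sub, smul_dotProduct, dotProduct_smul, smul_eq_mul,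
      dotProduct_comm c x, hss]
    rw [hβ]
    field_simp
    ring
  rw [pi_pi_gaussianReal_eq_withDensity,
    lintegral_withDensity_eq_lintegral_mul _ (by unfold dotProduct; fun_prop)
      (by unfold Matrix.mulVec dotProduct; simp only [Matrix.of_apply]; fun_prop),
    lintegral_withDensity_eq_lintegral_mul _ (by unfold dotProduct; fun_prop)
      (by fun_prop),
    ← lintegral_comp_linearMap volume (L := L) (by rw [hLdet]; positivity)
      (by unfold Matrix.mulVec dotProduct; simp only [Matrix.of_apply]; fun_prop),
    ← lintegral_const_mul _ (by unfold dotProduct; fun_prop),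
    ← lintegral_const_mul _ (by unfold dotProduct; fun_prop)]
  refine lintegral_congr fun C => ?_
  simp only [Pi.mul_apply, hLof, hLdet]
  rw [← ENNReal.ofReal_mul (by positivity), ← ENNReal.ofReal_mul (by positivity),
    ← ENNReal.ofReal_mul (by positivity), ← ENNReal.ofReal_mul (by positivity)]
  congr 1
  have h1 : Real.exp (-(∑ i, C i ⬝ᵥ C i) / 2) = Real.exp (-(∑ i, L C i ⬝ᵥ L C i) / 2) *
      Real.exp (-((Matrix.of (L C)).mulVec x ⬝ᵥ (Matrix.of (L C)).mulVec x) / 2) := by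
    rw [← Real.exp_add]
    congr 1
    have : ∑ i, C i ⬝ᵥ C i = ∑ i, L C i ⬝ᵥ L C i +
        (Matrix.of (L C)).mulVec x ⬝ᵥ (Matrix.of (L C)).mulVec x := by
      rw [dotProduct, ← Finset.sum_add_distrib]
      refine Finset.sum_congr rfl fun i _ => ?_
      rw [← hquad (C i)]
      rfl
    rw [this]
    ring
  have h2 : (1 + x ⬝ᵥ x) ^ (-((n + 1 : ℝ) / 2)) = s⁻¹ ^ n * s⁻¹ := by
    rw [← pow_succ, hs, inv_pow, Real.sqrt_eq_rpow, ← Real.rpow_natCast, ← Real.rpow_mul (by linarith),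
      ← Real.rpow_neg (by linarith)]
    push_cast
    ring_nf
  rw [h1, h2, abs_mul, abs_of_pos (inv_pos.2 hs0), abs_of_pos (by positivity : 0 < s⁻¹ ^ n)]
  ring

theorem lintegral_exp_neg_mulVec_mul_abs_det_le (n : ℕ) (C : Fin n → Fin n → ℝ) :
    ENNReal.ofReal ((√(2 * Real.pi))⁻¹ ^ n) * ∫⁻ x : Fin n → ℝ, ENNReal.ofReal
      (Real.exp (-((Matrix.of C).mulVec x ⬝ᵥ (Matrix.of C).mulVec x) / 2) * |(Matrix.of C).det|)
      ≤ 1 := by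
  by_cases hC : (Matrix.of C).det = 0
  · simp [hC]
  have hprob : ∫⁻ x : Fin n → ℝ, ENNReal.ofReal ((√(2 * Real.pi))⁻¹ ^ n *
      Real.exp (-(x ⬝ᵥ x) / 2)) = 1 := by
    have := measure_univ (μ := Measure.pi (fun _ : Fin n => gaussianReal 0 1))
    rwa [pi_gaussianReal_eq_withDensity, withDensity_apply _ MeasurableSet.univ,
      setLIntegral_univ] at this
  have hL : LinearMap.det (Matrix.toLin' (Matrix.of C)) ≠ 0 := by rwa [LinearMap.det_toLin']
  rw [← lintegral_comp_linearMap volume hL (by unfold dotProduct; fun_prop),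
    LinearMap.det_toLin'] at hprob
  refine le_of_eq ?_
  rw [← hprob, ← lintegral_const_mul _ (by unfold Matrix.mulVec dotProduct; fun_prop),
    ← lintegral_const_mul _ (by
      simp only [Matrix.toLin'_apply]; unfold Matrix.mulVec dotProduct; fun_prop)]
  refine lintegral_congr fun x => ?_
  rw [← ENNReal.ofReal_mul (by positivity), ← ENNReal.ofReal_mul (by positivity),
    Matrix.toLin'_apply]
  ring_nf

theorem lintegral_abs_det_gaussian_le (n : ℕ) :
    ENNReal.ofReal ((√(2 * Real.pi))⁻¹ ^ n) *
      ∫⁻ C : Fin n → Fin n → ℝ, ENNReal.ofReal |(Matrix.of C).det|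
      ∂(Measure.pi fun _ : Fin n => Measure.pi (fun _ : Fin n => gaussianReal 0 1)) ≤
    ENNReal.ofReal (Real.Gamma ((n + 1) / 2) * Real.pi ^ (-((n : ℝ) + 1) / 2)) := by
  set D := ∫⁻ C : Fin n → Fin n → ℝ, ENNReal.ofReal |(Matrix.of C).det|
      ∂(Measure.pi fun _ : Fin n => Measure.pi (fun _ : Fin n => gaussianReal 0 1)) with hD
  have hdet := measurable_det_fin n
  have hG : 0 < Real.Gamma ((n + 1 : ℝ) / 2) := Real.Gamma_pos_of_pos (by positivity)
  have h : ENNReal.ofReal ((√(2 * Real.pi))⁻¹ ^ n) * D *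
      ENNReal.ofReal (Real.pi ^ ((n + 1 : ℝ) / 2) / Real.Gamma ((n + 1) / 2)) ≤ 1 := by
    rw [← lintegral_one_add_dotProduct_self_rpow, mul_assoc, mul_comm D,
      ← lintegral_mul_const _ (by unfold dotProduct; fun_prop)]
    simp_rw [hD, ← lintegral_exp_mul_abs_det]
    have hmeas : Measurable (Function.uncurry fun (x : Fin n → ℝ) (C : Fin n → Fin n → ℝ) =>
        ENNReal.ofReal (Real.exp (-((Matrix.of C).mulVec x ⬝ᵥ (Matrix.of C).mulVec x) / 2) *
          |(Matrix.of C).det|)) := by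
      unfold Matrix.mulVec dotProduct
      simp only [Matrix.of_apply]
      fun_prop
    rw [lintegral_lintegral_swap hmeas.aemeasurable,
      ← lintegral_const_mul _ (by exact hmeas.lintegral_prod_left')]
    refine (lintegral_mono fun C => lintegral_exp_neg_mulVec_mul_abs_det_le n C).trans ?_
    simp
  calc _ ≤ (ENNReal.ofReal (Real.pi ^ ((n + 1 : ℝ) / 2) / Real.Gamma ((n + 1) / 2)))⁻¹ := by
        rwa [ENNReal.le_inv_iff_mul_le]
    _ = _ := by
        rw [← ENNReal.ofReal_inv_of_pos (by positivity), inv_div, neg_div,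
          Real.rpow_neg Real.pi_pos.le, div_eq_mul_inv]

section Area

variable {E : Type*} [NormedAddCommGroup E] [NormedSpace ℝ E] [FiniteDimensional ℝ E]

theorem exists_mem_nhds_injOn_of_det_ne_zero {g : E → E} {g' : E →L[ℝ] E} {x : E}
    (hg : HasStrictFDerivAt g g' x) (hdet : g'.det ≠ 0) :
    ∃ V, IsOpen V ∧ x ∈ V ∧ Set.InjOn g V := by
  have : CompleteSpace E := FiniteDimensional.complete ℝ E
  have hg2 : HasStrictFDerivAt g
      (g'.toContinuousLinearEquivOfDetNeZero hdet : E →L[ℝ] E) x := by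
    rwa [ContinuousLinearMap.coe_toContinuousLinearEquivOfDetNeZero]
  refine ⟨(hg2.toOpenPartialHomeomorph g).source, (hg2.toOpenPartialHomeomorph g).open_source,
    hg2.mem_toOpenPartialHomeomorph_source, ?_⟩
  simpa using (hg2.toOpenPartialHomeomorph g).injOn

variable [MeasurableSpace E] [BorelSpace E]

theorem exists_injOn_partition_regular {g : E → E}
    {g' : E → E →L[ℝ] E} (hg : ∀ x, HasStrictFDerivAt g (g' x) x) (hg' : Continuous g')
    {S : Set E} (hS : MeasurableSet S) :
    ∃ P : ℕ → Set E, (∀ k, MeasurableSet (P k)) ∧ (∀ k, Set.InjOn g (P k)) ∧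
      Pairwise (Function.onFun Disjoint P) ∧ ⋃ k, P k = S ∩ {x | (g' x).det ≠ 0} ∧
      ∀ u, (({x | x ∈ S ∧ g x = u ∧ (g' x).det ≠ 0}.encard : ℕ∞) : ℝ≥0∞) =
        ∑' k, (g '' P k).indicator 1 u := by
  have hgc : Continuous g := continuous_iff_continuousAt.2 fun x => (hg x).continuousAt
  have hSU : MeasurableSet (S ∩ {x | (g' x).det ≠ 0}) := by
    refine hS.inter (IsOpen.measurableSet ?_)
    exact isOpen_ne_fun (ContinuousLinearMap.continuous_det.comp hg') continuous_const
  have : ProperSpace E := FiniteDimensional.proper_real E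
  choose! V hVo hxV hVinj using fun x (hx : (g' x).det ≠ 0) =>
    exists_mem_nhds_injOn_of_det_ne_zero (hg x) hx
  obtain ⟨t, htU, htc, hUt⟩ := TopologicalSpace.countable_cover_nhdsWithin
    (s := {x | (g' x).det ≠ 0}) (f := V)
    fun x hx => mem_nhdsWithin_of_mem_nhds ((hVo x hx).mem_nhds (hxV x hx))
  obtain ⟨W, hWm, hWinj, hWcov⟩ : ∃ W : ℕ → Set E, (∀ k, MeasurableSet (W k)) ∧
      (∀ k, Set.InjOn g (W k)) ∧ {x | (g' x).det ≠ 0} ⊆ ⋃ k, W k := by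
    rcases t.eq_empty_or_nonempty with rfl | hne
    · exact ⟨fun _ => ∅, by simp, by simp, by simpa using hUt⟩
    · obtain ⟨e, rfl⟩ := htc.exists_eq_range hne
      refine ⟨fun k => V (e k), fun k => (hVo _ (htU ⟨k, rfl⟩)).measurableSet,
        fun k => hVinj _ (htU ⟨k, rfl⟩), ?_⟩
      simpa using hUt
  set P : ℕ → Set E := fun k => (S ∩ {x | (g' x).det ≠ 0}) ∩ disjointed W k with hP
  have hPm : ∀ k, MeasurableSet (P k) := fun k => hSU.inter (.disjointed hWm k)
  have hPinj : ∀ k, Set.InjOn g (P k) := fun k =>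
    (hWinj k).mono (Set.inter_subset_right.trans (disjointed_subset W k))
  have hPd : Pairwise (Function.onFun Disjoint P) := fun i j hij =>
    (disjoint_disjointed W hij).mono Set.inter_subset_right Set.inter_subset_right
  have hcov : S ∩ {x | (g' x).det ≠ 0} = ⋃ k, P k := by
    simp only [hP]
    rw [← Set.inter_iUnion, iUnion_disjointed]
    exact (Set.inter_eq_left.2 (Set.inter_subset_right.trans hWcov)).symm
  refine ⟨P, hPm, hPinj, hPd, hcov.symm, fun u => ?_⟩
  have heq : {x | x ∈ S ∧ g x = u ∧ (g' x).det ≠ 0} = ⋃ k, P k ∩ g ⁻¹' {u} := by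
    rw [← Set.iUnion_inter, ← hcov]
    ext
    simp only [Set.mem_ofPred_eq, Set.mem_inter_iff, Set.mem_preimage, Set.mem_singleton_iff]
    tauto
  have hPu : ∀ k, MeasurableSet (P k ∩ g ⁻¹' {u}) := fun k =>
    (hPm k).inter (hgc.measurable (measurableSet_singleton u))
  rw [heq, ← Measure.count_apply (.iUnion hPu), measure_iUnion (fun i j hij =>
    (hPd hij).mono Set.inter_subset_left Set.inter_subset_left) hPu]
  refine tsum_congr fun k => ?_
  rw [Measure.count_apply (hPu k)]
  by_cases hu : u ∈ g '' P k
  · rw [Set.indicator_of_mem hu, Pi.one_apply]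
    obtain ⟨x, hx, rfl⟩ := hu
    have : P k ∩ g ⁻¹' {g x} = {x} := by
      ext y
      simp only [Set.mem_inter_iff, Set.mem_preimage, Set.mem_singleton_iff]
      exact ⟨fun h => hPinj k h.1 hx h.2, by rintro rfl; exact ⟨hx, rfl⟩⟩
    simp [this]
  · have : P k ∩ g ⁻¹' {u} = ∅ := by
      ext x
      simp only [Set.mem_inter_iff, Set.mem_preimage, Set.mem_singleton_iff,
        Set.mem_empty_iff_false, iff_false, not_and]
      exact fun hx hxu => hu ⟨x, hx, hxu⟩
    simp [this, hu]

theorem measurable_encard_regular_preimage {g : E → E}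
    {g' : E → E →L[ℝ] E} (hg : ∀ x, HasStrictFDerivAt g (g' x) x) (hg' : Continuous g')
    {S : Set E} (hS : MeasurableSet S) :
    Measurable fun u =>
      (({x | x ∈ S ∧ g x = u ∧ (g' x).det ≠ 0}.encard : ℕ∞) : ℝ≥0∞) := by
  obtain ⟨P, hPm, hPinj, -, -, hcount⟩ := exists_injOn_partition_regular hg hg' hS
  simp_rw [hcount]
  exact Measurable.tsum fun k => measurable_one.indicator
    (measurable_image_of_fderivWithin (hPm k)
      (fun x _ => (hg x).hasFDerivAt.hasFDerivWithinAt) (hPinj k))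

theorem lintegral_encard_regular_preimage_le (μ : Measure E) [μ.IsAddHaarMeasure] {g : E → E}
    {g' : E → E →L[ℝ] E} (hg : ∀ x, HasStrictFDerivAt g (g' x) x) (hg' : Continuous g')
    {S : Set E} (hS : MeasurableSet S) :
    ∫⁻ u, (({x | x ∈ S ∧ g x = u ∧ (g' x).det ≠ 0}.encard : ℕ∞) : ℝ≥0∞) ∂μ ≤
      ∫⁻ x in S, ENNReal.ofReal |(g' x).det| ∂μ := by
  obtain ⟨P, hPm, hPinj, hPd, hcov, hcount⟩ := exists_injOn_partition_regular hg hg' hS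
  have hder : ∀ k, ∀ x ∈ P k, HasFDerivWithinAt g (g' x) (P k) x := fun k x _ =>
    (hg x).hasFDerivAt.hasFDerivWithinAt
  have himg : ∀ k, MeasurableSet (g '' P k) := fun k =>
    measurable_image_of_fderivWithin (hPm k) (hder k) (hPinj k)
  simp_rw [hcount]
  calc _ = ∑' k, μ (g '' P k) := by
        rw [lintegral_tsum fun k => (measurable_one.indicator (himg k)).aemeasurable]
        exact tsum_congr fun k => lintegral_indicator_one (himg k)
    _ = ∑' k, ∫⁻ x in P k, ENNReal.ofReal |(g' x).det| ∂μ := tsum_congr fun k =>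
        (lintegral_abs_det_fderiv_eq_addHaar_image μ (hPm k) (hder k) (hPinj k)).symm
    _ = ∫⁻ x in ⋃ k, P k, ENNReal.ofReal |(g' x).det| ∂μ := (lintegral_iUnion hPm hPd _).symm
    _ ≤ _ := lintegral_mono_set (hcov ▸ Set.inter_subset_left)

end Area

section ExpSystem

variable {ι : Type*} {n : ℕ}

/-- The vector of exponentials `exp ⟨b a, x⟩`. -/
def expVec (b : ι → Fin n → ℝ) (x : Fin n → ℝ) : ι → ℝ := fun a => Real.exp (b a ⬝ᵥ x)

/-- The Jacobian matrix of `expVec b`. -/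
def expJac (b : ι → Fin n → ℝ) (x : Fin n → ℝ) : Matrix ι (Fin n) ℝ :=
  Matrix.of fun a j => Real.exp (b a ⬝ᵥ x) * b a j

theorem continuous_expJac (b : ι → Fin n → ℝ) : Continuous (expJac b) := by
  unfold expJac dotProduct
  refine continuous_matrix fun a j => ?_
  simp only [Matrix.of_apply]
  fun_prop

theorem hasStrictFDerivAt_expVec (b : ι → Fin n → ℝ) (x : Fin n → ℝ) :
    HasStrictFDerivAt (expVec b) (Matrix.toLin' (expJac b x)).toContinuousLinearMap x := by
  refine hasStrictFDerivAt_pi'.2 fun a => ?_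
  have h := ((dotProductBilin ℝ ℝ (b a)).toContinuousLinearMap.hasStrictFDerivAt (x := x)).exp
  refine h.congr_fderiv ?_
  ext v
  simp [expJac, Matrix.mulVec, dotProduct, Finset.mul_sum, mul_assoc]

variable [Fintype ι]

theorem hasStrictFDerivAt_mulVec_expVec (b : ι → Fin n → ℝ) (C : Matrix (Fin n) ι ℝ)
    (x : Fin n → ℝ) :
    HasStrictFDerivAt (fun x => C.mulVec (expVec b x))
      (Matrix.toLin' (C * expJac b x)).toContinuousLinearMap x := by
  have h := ((Matrix.mulVecLin C).toContinuousLinearMap.hasStrictFDerivAt (x := expVec b x)).comp x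
    (hasStrictFDerivAt_expVec b x)
  refine h.congr_fderiv ?_
  ext v
  simp [Matrix.mulVec_mulVec]

theorem lintegral_abs_det_expJac_le (b : Fin n → Fin n → ℝ) {K : Set (Fin n → ℝ)}
    (hK : MeasurableSet K) (hKb : ∀ x ∈ K, ∀ a, b a ⬝ᵥ x ≤ 0) :
    ∫⁻ x in K, ENNReal.ofReal |(expJac b x).det| ≤ 1 := by
  have hdet : ∀ x, (expJac b x).det = (∏ a, Real.exp (b a ⬝ᵥ x)) * (Matrix.of b).det := fun x => by
    rw [← Matrix.det_mul_column]
    rfl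
  by_cases h0 : (Matrix.of b).det = 0
  · simp [hdet, h0]
  have hinj : Function.Injective (expVec b) := by
    intro x y hxy
    have h1 : (Matrix.of b).mulVec x = (Matrix.of b).mulVec y := by
      ext a
      exact Real.exp_injective (congrFun hxy a)
    exact Matrix.mulVec_injective_of_isUnit
      ((Matrix.isUnit_iff_isUnit_det _).2 (isUnit_iff_ne_zero.2 h0)) h1
  have h := lintegral_abs_det_fderiv_eq_addHaar_image volume hK
    (fun x _ => (hasStrictFDerivAt_expVec b x).hasFDerivAt.hasFDerivWithinAt) hinj.injOn
  simp only [LinearMap.det_toContinuousLinearMap, LinearMap.det_toLin'] at h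
  rw [h]
  calc volume (expVec b '' K) ≤ volume (Set.Icc (0 : Fin n → ℝ) 1) := by
        refine measure_mono ?_
        rintro _ ⟨x, hx, rfl⟩
        exact ⟨fun a => (Real.exp_pos _).le, fun a => Real.exp_le_one_iff.2 (hKb x hx a)⟩
    _ = 1 := by simp [Real.volume_Icc_pi]

theorem pi_gaussianReal_le_smul_volume (n : ℕ) :
    Measure.pi (fun _ : Fin n => gaussianReal 0 1) ≤
      ENNReal.ofReal ((√(2 * Real.pi))⁻¹ ^ n) • volume := by
  rw [pi_gaussianReal_eq_withDensity, ← withDensity_const]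
  refine withDensity_mono (.of_forall fun x => ENNReal.ofReal_le_ofReal ?_)
  have : 0 ≤ x ⬝ᵥ x := Finset.sum_nonneg fun i _ => mul_self_nonneg _
  exact mul_le_of_le_one_right (by positivity) (Real.exp_le_one_iff.2 (by linarith))

theorem measurePreserving_pi_comp_embedding {X : Type*} [MeasurableSpace X] (μ : Measure X)
    [IsProbabilityMeasure μ] {κ : Type*} [Fintype κ] (f : κ ↪ ι) :
    MeasurePreserving (fun c : ι → X => fun k => c (f k)) (Measure.pi fun _ => μ)
      (Measure.pi fun _ => μ) where
  measurable := by fun_prop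
  map_eq := by
    have h : iIndepFun (fun (i : ι) (c : ι → X) => c i) (Measure.pi fun _ => μ) :=
      iIndepFun_pi (X := fun _ => id) fun _ => aemeasurable_id
    rw [(iIndepFun_iff_map_fun_eq_pi_map (fun k => (measurable_pi_apply (f k)).aemeasurable)).1
      (h.precomp f.injective)]
    congr 1
    ext1 k
    exact (measurePreserving_eval (fun _ : ι => μ) (f k)).map_eq

theorem lintegral_abs_det_submatrix_gaussian (f : Fin n ↪ ι) :
    ∫⁻ C : Fin n → ι → ℝ, ENNReal.ofReal |((Matrix.of C).submatrix id f).det|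
      ∂(Measure.pi fun _ : Fin n => Measure.pi (fun _ : ι => gaussianReal 0 1)) =
    ∫⁻ C : Fin n → Fin n → ℝ, ENNReal.ofReal |(Matrix.of C).det|
      ∂(Measure.pi fun _ : Fin n => Measure.pi (fun _ : Fin n => gaussianReal 0 1)) := by
  have h := measurePreserving_pi (fun _ : Fin n => Measure.pi (fun _ : ι => gaussianReal 0 1))
    (fun _ : Fin n => Measure.pi (fun _ : Fin n => gaussianReal 0 1))
    fun _ => measurePreserving_pi_comp_embedding (gaussianReal 0 1) f
  have hdet := measurable_det_fin n
  rw [← h.lintegral_comp (by fun_prop)]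
  rfl

theorem lintegral_lintegral_abs_det_mul_expJac_le (b : ι → Fin n → ℝ) {K : Set (Fin n → ℝ)}
    (hK : MeasurableSet K) (hKb : ∀ x ∈ K, ∀ a, b a ⬝ᵥ x ≤ 0) :
    ∫⁻ C : Fin n → ι → ℝ, (∫⁻ x in K, ENNReal.ofReal |(Matrix.of C * expJac b x).det|)
      ∂(Measure.pi fun _ : Fin n => Measure.pi (fun _ : ι => gaussianReal 0 1)) ≤
    ((Fintype.card ι).choose n : ℝ≥0∞) *
      ∫⁻ C : Fin n → Fin n → ℝ, ENNReal.ofReal |(Matrix.of C).det|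
      ∂(Measure.pi fun _ : Fin n => Measure.pi (fun _ : Fin n => gaussianReal 0 1)) := by
  classical
  set D := ∫⁻ C : Fin n → Fin n → ℝ, ENNReal.ofReal |(Matrix.of C).det|
      ∂(Measure.pi fun _ : Fin n => Measure.pi (fun _ : Fin n => gaussianReal 0 1)) with hD
  have hJf : ∀ f : Fin n ↪ ι, ∀ x, (expJac b x).submatrix f id = expJac (b ∘ f) x := fun f x => rfl
  have hfac : (n.factorial : ℝ≥0∞) ≠ 0 := by exact_mod_cast n.factorial_ne_zero
  have hdet := measurable_det_fin n
  have hmC : ∀ f : Fin n ↪ ι, Measurable fun C : Fin n → ι → ℝ =>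
      ENNReal.ofReal |((Matrix.of C).submatrix id f).det| := fun f =>
    (hdet.comp (g := fun C : Fin n → Fin n → ℝ => (Matrix.of C).det)
      (f := fun (C : Fin n → ι → ℝ) i j => C i (f j)) (by fun_prop)).abs.ennreal_ofReal
  have hmJ : ∀ f : Fin n ↪ ι, Measurable fun x : Fin n → ℝ =>
      ENNReal.ofReal |((expJac b x).submatrix f id).det| := fun f => by
    have : Continuous fun x => |((expJac b x).submatrix f id).det| :=
      ((continuous_expJac b).matrix_submatrix f id).matrix_det.abs
    exact this.measurable.ennreal_ofReal
  have hpt : ∀ (C : Fin n → ι → ℝ) x, (n.factorial : ℝ≥0∞) *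
      ENNReal.ofReal |(Matrix.of C * expJac b x).det| ≤
      ∑ f : Fin n ↪ ι, ENNReal.ofReal |((Matrix.of C).submatrix id f).det| *
        ENNReal.ofReal |((expJac b x).submatrix f id).det| := by
    intro C x
    have h1 : (n.factorial : ℝ) * |(Matrix.of C * expJac b x).det| ≤
        ∑ f : Fin n ↪ ι, |((Matrix.of C).submatrix id f).det| *
          |((expJac b x).submatrix f id).det| := by
      rw [← Nat.abs_cast, ← abs_mul, factorial_mul_det_mul]
      refine (Finset.abs_sum_le_sum_abs _ _).trans_eq ?_
      simp_rw [abs_mul]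
    rw [← ENNReal.ofReal_natCast, ← ENNReal.ofReal_mul (by positivity)]
    simp_rw [← ENNReal.ofReal_mul (abs_nonneg _)]
    rw [← ENNReal.ofReal_sum_of_nonneg fun _ _ => by positivity]
    exact ENNReal.ofReal_le_ofReal h1
  have hmain : (n.factorial : ℝ≥0∞) *
      ∫⁻ C : Fin n → ι → ℝ, (∫⁻ x in K, ENNReal.ofReal |(Matrix.of C * expJac b x).det|)
      ∂(Measure.pi fun _ : Fin n => Measure.pi (fun _ : ι => gaussianReal 0 1)) ≤
      ((Fintype.card ι).descFactorial n : ℝ≥0∞) * D := by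
    rw [← lintegral_const_mul' _ _ (ENNReal.natCast_ne_top _)]
    simp_rw [← lintegral_const_mul' _ _ (ENNReal.natCast_ne_top n.factorial)]
    calc _ ≤ ∫⁻ C : Fin n → ι → ℝ, (∫⁻ x in K, ∑ f : Fin n ↪ ι,
          ENNReal.ofReal |((Matrix.of C).submatrix id f).det| *
          ENNReal.ofReal |((expJac b x).submatrix f id).det|)
          ∂(Measure.pi fun _ : Fin n => Measure.pi (fun _ : ι => gaussianReal 0 1)) :=
          lintegral_mono fun C => lintegral_mono fun x => hpt C x
      _ = ∫⁻ C : Fin n → ι → ℝ, ∑ f : Fin n ↪ ι,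
          (ENNReal.ofReal |((Matrix.of C).submatrix id f).det| *
          ∫⁻ x in K, ENNReal.ofReal |((expJac b x).submatrix f id).det|)
          ∂(Measure.pi fun _ : Fin n => Measure.pi (fun _ : ι => gaussianReal 0 1)) := by
          refine lintegral_congr fun C => ?_
          rw [lintegral_finsetSum _ fun f _ => (hmJ f).const_mul _]
          simp_rw [lintegral_const_mul _ (hmJ _)]
      _ ≤ ∫⁻ C : Fin n → ι → ℝ, ∑ f : Fin n ↪ ι,
          ENNReal.ofReal |((Matrix.of C).submatrix id f).det|
          ∂(Measure.pi fun _ : Fin n => Measure.pi (fun _ : ι => gaussianReal 0 1)) := by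
          refine lintegral_mono fun C => Finset.sum_le_sum fun f _ => ?_
          simp_rw [hJf]
          exact mul_le_of_le_one_right' (lintegral_abs_det_expJac_le (b ∘ f) hK
            fun x hx a => hKb x hx (f a))
      _ = ∑ f : Fin n ↪ ι, D := by
          rw [lintegral_finsetSum _ fun f _ => hmC f]
          exact Finset.sum_congr rfl fun f _ => lintegral_abs_det_submatrix_gaussian f
      _ = _ := by simp [Fintype.card_embedding_eq]
  rw [Nat.descFactorial_eq_factorial_mul_choose, Nat.cast_mul, mul_assoc] at hmain
  exact (ENNReal.mul_le_mul_iff_right hfac (ENNReal.natCast_ne_top _)).1 hmain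

theorem lintegral_encard_exp_system_le (b : ι → Fin n → ℝ) {K : Set (Fin n → ℝ)}
    (hK : MeasurableSet K) (hKb : ∀ x ∈ K, ∀ a, b a ⬝ᵥ x ≤ 0) :
    ∫⁻ C : Fin n → ι → ℝ, ∫⁻ u : Fin n → ℝ,
      (({x | x ∈ K ∧ (-(Matrix.of C)).mulVec (expVec b x) = u ∧
        (Matrix.of C * expJac b x).det ≠ 0}.encard : ℕ∞) : ℝ≥0∞)
      ∂(Measure.pi fun _ : Fin n => gaussianReal 0 1)
      ∂(Measure.pi fun _ : Fin n => Measure.pi (fun _ : ι => gaussianReal 0 1)) ≤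
    ENNReal.ofReal (Real.Gamma ((n + 1) / 2) * Real.pi ^ (-((n : ℝ) + 1) / 2)) *
      ((Fintype.card ι).choose n : ℝ≥0∞) := by
  have h1 : ∀ C : Fin n → ι → ℝ, ∫⁻ u : Fin n → ℝ,
      (({x | x ∈ K ∧ (-(Matrix.of C)).mulVec (expVec b x) = u ∧
        (Matrix.of C * expJac b x).det ≠ 0}.encard : ℕ∞) : ℝ≥0∞)
      ∂(Measure.pi fun _ : Fin n => gaussianReal 0 1) ≤
      ENNReal.ofReal ((√(2 * Real.pi))⁻¹ ^ n) *
        ∫⁻ x in K, ENNReal.ofReal |(Matrix.of C * expJac b x).det| := by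
    intro C
    refine (lintegral_mono' (pi_gaussianReal_le_smul_volume n) le_rfl).trans ?_
    rw [lintegral_smul_measure, smul_eq_mul]
    refine mul_le_mul_right ?_ _
    have hneg : ∀ x, (-(Matrix.of C) * expJac b x).det =
        (-1) ^ n * (Matrix.of C * expJac b x).det := fun x => by
      rw [Matrix.neg_mul, Matrix.det_neg, Fintype.card_fin]
    have h := lintegral_encard_regular_preimage_le volume
      (hasStrictFDerivAt_mulVec_expVec b (-(Matrix.of C))) (S := K) (by
        have h2 : Continuous fun x => -(Matrix.of C) * expJac b x :=
          continuous_const.matrix_mul (continuous_expJac b)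
        exact (((Matrix.toLin' (R := ℝ) (m := Fin n) (n := Fin n)).trans
          LinearMap.toContinuousLinearMap).toLinearMap.continuous_of_finiteDimensional).comp h2) hK
    simpa only [LinearMap.det_toContinuousLinearMap, LinearMap.det_toLin', hneg, abs_mul, abs_pow,
      abs_neg, abs_one, one_pow, one_mul, ne_eq, mul_eq_zero, pow_eq_zero_iff', neg_eq_zero,
      one_ne_zero, false_and, false_or] using h
  refine (lintegral_mono h1).trans ?_
  rw [lintegral_const_mul' _ _ ENNReal.ofReal_ne_top]
  refine (mul_le_mul_right (lintegral_lintegral_abs_det_mul_expJac_le b hK hKb) _).trans ?_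
  rw [mul_left_comm, mul_comm]
  exact mul_le_mul_left (lintegral_abs_det_gaussian_le n) _

theorem det_ne_zero_iff_injective {V : Type*} [AddCommGroup V] [Module ℝ V]
    [FiniteDimensional ℝ V] (L : V →ₗ[ℝ] V) : LinearMap.det L ≠ 0 ↔ Function.Injective L := by
  rw [← isUnit_iff_ne_zero, ← LinearMap.isUnit_iff_isUnit_det, LinearMap.isUnit_iff_ker_eq_bot,
    LinearMap.ker_eq_bot]

/-- The incidence map `(C, x) ↦ (C, -C exp(b x))`. -/
def incidenceMap (b : ι → Fin n → ℝ) (p : (Fin n → ι → ℝ) × (Fin n → ℝ)) :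
    (Fin n → ι → ℝ) × (Fin n → ℝ) :=
  (p.1, (-(Matrix.of p.1)).mulVec (expVec b p.2))

theorem contDiff_incidenceMap (b : ι → Fin n → ℝ) : ContDiff ℝ 1 (incidenceMap b) := by
  unfold incidenceMap expVec Matrix.mulVec dotProduct
  simp only [Matrix.neg_apply, Matrix.of_apply]
  fun_prop

theorem det_fderiv_incidenceMap_ne_zero_iff (b : ι → Fin n → ℝ)
    (p : (Fin n → ι → ℝ) × (Fin n → ℝ)) :
    (fderiv ℝ (incidenceMap b) p).det ≠ 0 ↔ (Matrix.of p.1 * expJac b p.2).det ≠ 0 := by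
  have hG : HasFDerivAt (incidenceMap b) (fderiv ℝ (incidenceMap b) p) p :=
    ((contDiff_incidenceMap b).differentiable one_ne_zero p).hasFDerivAt
  set L := fderiv ℝ (incidenceMap b) p
  have h1 : ∀ q, (L q).1 = q.1 := by
    have := (hasFDerivAt_fst (𝕜 := ℝ)).comp p hG
    have h2 := this.unique (hasFDerivAt_fst (𝕜 := ℝ) (p := p))
    intro q
    exact congrArg (fun f => f q) h2
  have h2 : ∀ z, (L (0, z)).2 = -((Matrix.of p.1 * expJac b p.2).mulVec z) := by
    have h3 := (hasFDerivAt_snd (𝕜 := ℝ)).comp p.2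
      (HasFDerivAt.comp p.2 (g := incidenceMap b) (f := fun x => (p.1, x)) hG
        (hasFDerivAt_prodMk_right p.1 p.2))
    have h4 := h3.unique (hasStrictFDerivAt_mulVec_expVec b (-(Matrix.of p.1)) p.2).hasFDerivAt
    intro z
    have h5 : (L (0, z)).2 = (-(Matrix.of p.1) * expJac b p.2).mulVec z :=
      congrArg (fun f => f z) h4
    rw [h5, Matrix.neg_mul, Matrix.neg_mulVec]
  rw [← LinearMap.det_toLin', det_ne_zero_iff_injective,
    det_ne_zero_iff_injective, injective_iff_map_eq_zero, injective_iff_map_eq_zero]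
  constructor
  · intro h z hz
    have : L (0, z) = 0 := by
      refine Prod.ext (by simp [h1]) ?_
      rw [h2, ← Matrix.toLin'_apply, hz]
      simp
    exact congrArg Prod.snd (h _ this)
  · rintro h ⟨δ, z⟩ hq
    have hq : L (δ, z) = 0 := hq
    obtain rfl : δ = 0 := by simpa [hq] using (h1 (δ, z)).symm
    have := h2 z
    rw [hq] at this
    have hz := h z (by simpa using this.symm)
    simp [hz]

theorem measurable_encard_exp_system (b : ι → Fin n → ℝ) {K : Set (Fin n → ℝ)}
    (hK : MeasurableSet K) :
    Measurable fun p : (Fin n → ι → ℝ) × (Fin n → ℝ) =>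
      (({x | x ∈ K ∧ (-(Matrix.of p.1)).mulVec (expVec b x) = p.2 ∧
        (Matrix.of p.1 * expJac b x).det ≠ 0}.encard : ℕ∞) : ℝ≥0∞) := by
  have h := measurable_encard_regular_preimage (g := incidenceMap b)
    (fun p => (contDiff_incidenceMap b).contDiffAt.hasStrictFDerivAt one_ne_zero)
    ((contDiff_incidenceMap b).continuous_fderiv one_ne_zero)
    (S := Prod.snd ⁻¹' K) (measurable_snd hK)
  convert h using 4 with p
  have : {q | q ∈ Prod.snd ⁻¹' K ∧ incidenceMap b q = p ∧
      (fderiv ℝ (incidenceMap b) q).det ≠ 0} = (fun x => (p.1, x)) ''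
      {x | x ∈ K ∧ (-(Matrix.of p.1)).mulVec (expVec b x) = p.2 ∧
        (Matrix.of p.1 * expJac b x).det ≠ 0} := by
    ext ⟨C, x⟩
    simp only [det_fderiv_incidenceMap_ne_zero_iff, Set.mem_ofPred_eq, Set.mem_preimage,
      Set.mem_image, incidenceMap, Prod.ext_iff]
    constructor
    · rintro ⟨h1, ⟨rfl, h2⟩, h3⟩
      exact ⟨x, ⟨h1, h2, h3⟩, rfl, rfl⟩
    · rintro ⟨y, ⟨h1, h2, h3⟩, rfl, rfl⟩
      exact ⟨h1, ⟨rfl, h2⟩, h3⟩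
  rw [this, (Prod.mk_right_injective p.1).encard_image]

end ExpSystem

theorem measurePreserving_split_coeff {α : Type*} [Fintype α] [DecidableEq α] (v : α) (n : ℕ)
    (μ : Measure ℝ) [IsProbabilityMeasure μ] :
    MeasurePreserving (fun c : Fin n → α → ℝ =>
        ((fun i (a : {a // ¬ a = v}) => c i a, fun i => c i v) :
          (Fin n → {a // ¬ a = v} → ℝ) × (Fin n → ℝ)))
      (Measure.pi fun _ => Measure.pi fun _ => μ)
      ((Measure.pi fun _ => Measure.pi fun _ => μ).prod (Measure.pi fun _ => μ)) := by
  have h1 := measurePreserving_piEquivPiSubtypeProd (fun _ : α => μ) (fun a => a = v)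
  rw [Subsingleton.elim (Subtype.fintype fun a => a = v) Unique.fintype] at h1
  have h2 := (measurePreserving_funUnique μ {a // a = v}).prod
    (MeasurePreserving.id (Measure.pi fun _ : {a // ¬ a = v} => μ))
  have h3 : MeasurePreserving (fun c : α → ℝ =>
      ((fun a : {a // ¬ a = v} => c a, c v) : ({a // ¬ a = v} → ℝ) × ℝ))
      (Measure.pi fun _ => μ) ((Measure.pi fun _ => μ).prod μ) := by
    exact Measure.measurePreserving_swap.comp (h2.comp h1)
  exact (measurePreserving_arrowProdEquivProdArrow ({a // ¬ a = v} → ℝ) ℝ (Fin n) _ _).comp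
    (measurePreserving_pi (fun _ : Fin n => Measure.pi fun _ : α => μ) _ fun _ => h3)

/-- The maximum of a linear functional over a finite set is attained at a vertex of its
convex hull. -/
theorem exists_extremePoint_forall_inner_le_s2 {n : ℕ} (A : Finset (EuclideanSpace ℝ (Fin n)))
    (hA : A.Nonempty) (w : EuclideanSpace ℝ (Fin n)) :
    ∃ v ∈ Set.extremePoints ℝ (convexHull ℝ (A : Set (EuclideanSpace ℝ (Fin n)))),
      ∀ a ∈ A, ⟪a, w⟫ ≤ ⟪v, w⟫ := by
  set P := convexHull ℝ (A : Set (EuclideanSpace ℝ (Fin n))) with hP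
  have hPc : IsCompact P := A.finite_toSet.isCompact_convexHull (𝕜 := ℝ)
  have hfin : (Set.extremePoints ℝ P).Finite :=
    A.finite_toSet.subset extremePoints_convexHull_subset
  have hne : (Set.extremePoints ℝ P).Nonempty :=
    hPc.extremePoints_nonempty (hA.to_set.mono (subset_convexHull ℝ _))
  obtain ⟨v, hv, hmax⟩ := hfin.exists_maximalFor (fun v => ⟪v, w⟫) _ hne
  refine ⟨v, hv, fun a ha => ?_⟩
  have hsub : closure (convexHull ℝ (Set.extremePoints ℝ P)) ⊆ {y | ⟪y, w⟫ ≤ ⟪v, w⟫} := by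
    refine closure_minimal (convexHull_min (fun y hy => ?_) ?_) ?_
    · exact (le_total ⟪y, w⟫ ⟪v, w⟫).elim id fun h => hmax hy h
    · exact convex_halfSpace_le ⟨fun x y => inner_add_left x y w,
        fun c x => real_inner_smul_left x w c⟩ _
    · exact isClosed_le (by fun_prop) continuous_const
  rw [closure_convexHull_extremePoints hPc (convex_convexHull ℝ _)] at hsub
  exact hsub (subset_convexHull ℝ _ ha)

/-- The exponents of the system after division by the monomial `exp ⟪v, w⟫`. -/
def shiftedExponents {n : ℕ} {A : Finset (EuclideanSpace ℝ (Fin n))} (v : A) :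
    {a : A // ¬ a = v} → Fin n → ℝ :=
  fun a => WithLp.ofLp (((a : A) : EuclideanSpace ℝ (Fin n)) - (v : EuclideanSpace ℝ (Fin n)))

theorem shiftedExponents_dotProduct {n : ℕ} {A : Finset (EuclideanSpace ℝ (Fin n))} (v : A)
    (a : {a : A // ¬ a = v}) (w : EuclideanSpace ℝ (Fin n)) :
    shiftedExponents v a ⬝ᵥ WithLp.ofLp w =
      ⟪((a : A) : EuclideanSpace ℝ (Fin n)), w⟫ - ⟪(v : EuclideanSpace ℝ (Fin n)), w⟫ := by
  simp [shiftedExponents, EuclideanSpace.inner_eq_star_dotProduct, dotProduct_comm]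

open Classical in
theorem sysF_eq_exp_smul {n : ℕ} (A : Finset (EuclideanSpace ℝ (Fin n))) (v : A)
    (c : Fin n → A → ℝ) (w : EuclideanSpace ℝ (Fin n)) :
    sysF (fun _ => A) c w = Real.exp ⟪(v : EuclideanSpace ℝ (Fin n)), w⟫ •
      ((fun i => c i v) + (Matrix.of fun i (a : {a : A // ¬ a = v}) => c i a).mulVec
        (expVec (shiftedExponents v) (WithLp.ofLp w))) := by
  ext i
  have hexp : ∀ a : {a : A // ¬ a = v},
      Real.exp ⟪((a : A) : EuclideanSpace ℝ (Fin n)), w⟫ =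
        Real.exp ⟪(v : EuclideanSpace ℝ (Fin n)), w⟫ *
          expVec (shiftedExponents v) (WithLp.ofLp w) a := by
    intro a
    rw [expVec, shiftedExponents_dotProduct, ← Real.exp_add]
    ring_nf
  simp only [sysF, Fexp, Pi.smul_apply, Pi.add_apply, smul_eq_mul, Matrix.mulVec, dotProduct,
    Matrix.of_apply, mul_add, Finset.mul_sum]
  rw [← Finset.add_sum_erase _ _ (Finset.mem_univ v), mul_comm]
  congr 1
  rw [Finset.sum_subtype (Finset.univ.erase v) (p := fun a => ¬ a = v) (by simp)]
  refine Finset.sum_congr rfl fun a _ => ?_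
  rw [hexp]
  ring

open Classical in
theorem mulVec_eq_and_det_ne_zero_of_mem_nondegZeros {n : ℕ}
    (A : Finset (EuclideanSpace ℝ (Fin n))) (v : A) (c : Fin n → A → ℝ)
    {w : EuclideanSpace ℝ (Fin n)} (hw : w ∈ nondegZeros (fun _ => A) c) :
    (-(Matrix.of fun i (a : {a : A // ¬ a = v}) => c i a)).mulVec
        (expVec (shiftedExponents v) (WithLp.ofLp w)) = (fun i => c i v) ∧
      ((Matrix.of fun i (a : {a : A // ¬ a = v}) => c i a) *
        expJac (shiftedExponents v) (WithLp.ofLp w)).det ≠ 0 := by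
  obtain ⟨h0, hbij⟩ := hw
  set C : Matrix (Fin n) {a : A // ¬ a = v} ℝ := Matrix.of fun i a => c i a
  rw [sysF_eq_exp_smul A v c w, smul_eq_zero_iff_right (Real.exp_pos _).ne'] at h0
  refine ⟨by rw [Matrix.neg_mulVec]; exact (eq_neg_of_add_eq_zero_left h0).symm, ?_⟩
  have hh : HasFDerivAt (fun w : EuclideanSpace ℝ (Fin n) => (fun i => c i v) +
      C.mulVec (expVec (shiftedExponents v) (WithLp.ofLp w)))
      ((Matrix.toLin' (C * expJac (shiftedExponents v) (WithLp.ofLp w))).toContinuousLinearMap.comp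
        (EuclideanSpace.equiv (Fin n) ℝ).toContinuousLinearMap) w :=
    ((hasStrictFDerivAt_mulVec_expVec (shiftedExponents v) C (WithLp.ofLp w)).hasFDerivAt.comp w
      (EuclideanSpace.equiv (Fin n) ℝ).toContinuousLinearMap.hasFDerivAt).const_add _
  have he : HasFDerivAt
      (fun w : EuclideanSpace ℝ (Fin n) => Real.exp ⟪(v : EuclideanSpace ℝ (Fin n)), w⟫)
      _ w := ((innerSL ℝ (v : EuclideanSpace ℝ (Fin n))).hasFDerivAt (x := w)).exp
  have hs := he.smul hh
  rw [h0, ContinuousLinearMap.smulRight_zero, add_zero] at hs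
  have hfd := (hs.congr_of_eventuallyEq (.of_forall (sysF_eq_exp_smul A v c))).fderiv
  rw [hfd] at hbij
  rw [← LinearMap.det_toLin', det_ne_zero_iff_injective]
  have hinj := (EuclideanSpace.equiv (Fin n) ℝ).symm.injective
  intro x y hxy
  refine hinj (hbij.1 ?_)
  simp only [smul_apply, ContinuousLinearMap.comp_apply]
  congr 1

open Classical in
theorem encard_nondegZeros_inter_le {n : ℕ} (A : Finset (EuclideanSpace ℝ (Fin n))) (v : A)
    (c : Fin n → A → ℝ) :
    (nondegZeros (fun _ => A) c ∩
        {w | ∀ a ∈ A, ⟪a, w⟫ ≤ ⟪(v : EuclideanSpace ℝ (Fin n)), w⟫}).encard ≤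
      {x | x ∈ {x | ∀ a, shiftedExponents v a ⬝ᵥ x ≤ 0} ∧
        (-(Matrix.of fun i (a : {a : A // ¬ a = v}) => c i a)).mulVec
          (expVec (shiftedExponents v) x) = (fun i => c i v) ∧
        ((Matrix.of fun i (a : {a : A // ¬ a = v}) => c i a) *
          expJac (shiftedExponents v) x).det ≠ 0}.encard := by
  rw [← (WithLp.ofLp_injective 2).encard_image]
  refine Set.encard_le_encard ?_
  rintro _ ⟨w, ⟨hw, hwv⟩, rfl⟩
  refine ⟨fun a => ?_, mulVec_eq_and_det_ne_zero_of_mem_nondegZeros A v c hw⟩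
  have h := hwv a a.1.2
  rw [shiftedExponents_dotProduct]
  linarith

/-- The number of nondegenerate zeros in the normal cone of a point of the support has a measurable
majorant of controlled expectation. -/
theorem exists_measurable_encard_nondegZeros_inter_le {n : ℕ}
    (A : Finset (EuclideanSpace ℝ (Fin n))) (v : EuclideanSpace ℝ (Fin n)) (hv : v ∈ A) :
    ∃ H : (Fin n → A → ℝ) → ℝ≥0∞, Measurable H ∧
      (∀ c, (((nondegZeros (fun _ => A) c ∩ {w | ∀ a ∈ A, ⟪a, w⟫ ≤ ⟪v, w⟫}).encard : ℕ∞) : ℝ≥0∞)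
        ≤ H c) ∧
      ∫⁻ c, H c ∂(coeffMeasure fun _ => A) ≤
        ENNReal.ofReal (Real.Gamma ((n + 1) / 2) * Real.pi ^ (-((n : ℝ) + 1) / 2)) *
          ((A.card - 1).choose n : ℝ≥0∞) := by
  classical
  set v' : A := ⟨v, hv⟩
  set K : Set (Fin n → ℝ) := {x | ∀ a, shiftedExponents v' a ⬝ᵥ x ≤ 0} with hK
  have hKm : MeasurableSet K := by
    simp only [hK, Set.ofPred_forall, dotProduct]
    exact MeasurableSet.iInter fun a => measurableSet_le (by fun_prop) measurable_const
  have hmeas := measurable_encard_exp_system (shiftedExponents v') hKm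
  have hS := measurePreserving_split_coeff v' n (gaussianReal 0 1)
  refine ⟨_, hmeas.comp hS.measurable, fun c => ?_, ?_⟩
  · exact ENat.toENNReal_mono (encard_nondegZeros_inter_le A v' c)
  · refine (hS.lintegral_comp hmeas).trans_le ?_
    rw [lintegral_prod _ hmeas.aemeasurable]
    refine (lintegral_encard_exp_system_le (shiftedExponents v') hKm fun x hx => hx).trans_eq ?_
    simp [Fintype.card_subtype_compl]

/-- Proposition 1.4 (unmixed case): for `A ⊆ ℝ^n` of cardinality `t ≥ 1` whose convex hull
has `V₀` vertices, `E(A,…,A) ≤ vol(ℙ^n)⁻¹ · V₀ · C(t-1, n)`,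
where `vol(ℙ^n)⁻¹ = Γ((n+1)/2) · π^{-(n+1)/2}`. -/
theorem main_unmixed_real {n : ℕ} (A : Finset (EuclideanSpace ℝ (Fin n)))
    (t : ℕ) (ht : t = A.card) (ht1 : 1 ≤ t)
    (V₀ : ℕ)
    (hV₀ : V₀ = (Set.extremePoints ℝ
      (convexHull ℝ (A : Set (EuclideanSpace ℝ (Fin n))))).ncard) :
    EE (fun _ : Fin n => A) ≤ ENNReal.ofReal
      (Real.Gamma ((n + 1) / 2) * Real.pi ^ (-((n : ℝ) + 1) / 2) * V₀ *
        (Nat.choose (t - 1) n)) := by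
  classical
  subst ht
  set V := Set.extremePoints ℝ (convexHull ℝ (A : Set (EuclideanSpace ℝ (Fin n)))) with hV
  have hVA : V ⊆ A := extremePoints_convexHull_subset
  have hfin : V.Finite := A.finite_toSet.subset hVA
  choose! H hHm hHle hHint using exists_measurable_encard_nondegZeros_inter_le A
  have hVm : ∀ v ∈ hfin.toFinset, v ∈ A := fun v hv => hVA (hfin.mem_toFinset.1 hv)
  have hcover : ∀ c : Fin n → A → ℝ, (((nondegZeros (fun _ => A) c).encard : ℕ∞) : ℝ≥0∞) ≤
      ∑ v ∈ hfin.toFinset, H v c := by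
    intro c
    have hsub : nondegZeros (fun _ => A) c ⊆ ⋃ v ∈ hfin.toFinset,
        nondegZeros (fun _ => A) c ∩ {w | ∀ a ∈ A, ⟪a, w⟫ ≤ ⟪v, w⟫} := by
      intro w hw
      obtain ⟨v, hv, hmax⟩ := exists_extremePoint_forall_inner_le_s2 A (Finset.card_pos.1 ht1) w
      exact Set.mem_biUnion (hfin.mem_toFinset.2 hv) ⟨hw, hmax⟩
    have hle := (Set.encard_le_encard hsub).trans (Finset.set_encard_biUnion_le _ _)
    refine le_trans (b := ∑ v ∈ hfin.toFinset, (((nondegZeros (fun _ => A) c ∩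
      {w | ∀ a ∈ A, ⟪a, w⟫ ≤ ⟪v, w⟫}).encard : ℕ∞) : ℝ≥0∞)) ?_
      (Finset.sum_le_sum fun v hv => hHle v (hVm v hv) c)
    exact (ENat.toENNReal_mono hle).trans_eq (map_sum ENat.toENNRealRingHom _ _)
  calc EE (fun _ : Fin n => A)
      ≤ ∫⁻ c, ∑ v ∈ hfin.toFinset, H v c ∂(coeffMeasure fun _ => A) := lintegral_mono hcover
    _ = ∑ v ∈ hfin.toFinset, ∫⁻ c, H v c ∂(coeffMeasure fun _ => A) :=
        lintegral_finsetSum _ fun v hv => hHm v (hVm v hv)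
    _ ≤ ∑ v ∈ hfin.toFinset, ENNReal.ofReal (Real.Gamma ((n + 1) / 2) *
          Real.pi ^ (-((n : ℝ) + 1) / 2)) * ((A.card - 1).choose n : ℝ≥0∞) :=
        Finset.sum_le_sum fun v hv => hHint v (hVm v hv)
    _ = _ := by
        have hG : 0 ≤ Real.Gamma (((n : ℝ) + 1) / 2) * Real.pi ^ (-((n : ℝ) + 1) / 2) :=
          mul_nonneg (Real.Gamma_pos_of_pos (by positivity)).le (by positivity)
        rw [Finset.sum_const, nsmul_eq_mul, ← Set.ncard_eq_toFinset_card V hfin, ← hV₀,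
          ENNReal.ofReal_mul (mul_nonneg hG V₀.cast_nonneg), ENNReal.ofReal_mul hG,
          ENNReal.ofReal_natCast, ENNReal.ofReal_natCast]
        ring

end
end
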